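/- arXiv:0902.2159 — 7 statements merged into one kernel-verified Lean document; each statement's English description precedes it below -/
import Mathlib

section
/- If F is a divisibly closed supertropical semifield, then there exists a tangible retract function ν̂: F → T_0 (restricting to the identity on tangibles, with ν(ν̂(b)) = b for all ghosts b) whose restriction to the group G of nonzero ghosts is a multiplicative group homomorphism G → T. -/
/-- A supertropical semiring: a semiring with a ghost ideal `isGhost`,
whose ghost map `ν a = a + a` is an idempotent map into the ghost ideal,
satisfying the supertropical axioms. -/
class SupertropicalSemiring (R : Type*) extends Semiring R where
  isGhost : R → Prop
  ghost_zero : isGhost 0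
  ghost_add : ∀ {a b : R}, isGhost a → isGhost b → isGhost (a + b)
  ghost_mul_left : ∀ (a : R) {b : R}, isGhost b → isGhost (a * b)
  ghost_mul_right : ∀ (a : R) {b : R}, isGhost b → isGhost (b * a)
  nu_ghost : ∀ a : R, isGhost (a + a)
  nu_idem : ∀ a : R, (a + a) + (a + a) = a + a
  add_eq_nu : ∀ {a b : R}, a + a = b + b → a + b = a + a
  add_cases : ∀ {a b : R}, a + a ≠ b + b → a + b = a ∨ a + b = b

namespace ST

variable {R : Type*}

/-- The ghost predicate. -/
abbrev ghost [SupertropicalSemiring R] (a : R) : Prop := SupertropicalSemiring.isGhost a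

/-- `a` is tangible if it is not a ghost (in particular `a ≠ 0`). -/
abbrev tangible [SupertropicalSemiring R] (a : R) : Prop := ¬ ghost a

/-- `a` lies in `T₀ = T ∪ {0}`. -/
abbrev tangible0 [SupertropicalSemiring R] (a : R) : Prop := a = 0 ∨ tangible a

/-- `b` ghost-surpasses `a`: `b = a + ghost`. -/
def GS [SupertropicalSemiring R] (b a : R) : Prop := ∃ c : R, ghost c ∧ b = a + c

/-- `a` and `b` are ν-matched: `ν a = ν b`. -/
def nuEq [SupertropicalSemiring R] (a b : R) : Prop := a + a = b + b

/-- `a ≤_ν b`, i.e. `ν a ≤ ν b` in the ordered ghost ideal. -/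
def nuLe [SupertropicalSemiring R] (a b : R) : Prop := (a + a) + (b + b) = b + b

end ST

/-- A supertropical domain: a commutative supertropical semiring in which the
tangible elements form a multiplicative monoid and `ν` maps the tangibles onto
the nonzero ghosts. -/
class SupertropicalDomain (R : Type*) extends SupertropicalSemiring R where
  mul_comm : ∀ a b : R, a * b = b * a
  one_tangible : ¬ isGhost 1
  tangible_mul : ∀ {a b : R}, ¬ isGhost a → ¬ isGhost b → ¬ isGhost (a * b)
  nu_onto : ∀ {g : R}, isGhost g → g ≠ 0 → ∃ t : R, ¬ isGhost t ∧ t + t = g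

/-- A supertropical semifield: every tangible element is invertible. -/
class SupertropicalSemifield (R : Type*) extends SupertropicalDomain R where
  tangible_inv : ∀ {a : R}, ¬ isGhost a → ∃ b : R, ¬ isGhost b ∧ a * b = 1

namespace ST

/-- A tangible retract function `ν̂ : R → T₀`: the identity on `T₀`, and a
section of `ν` on the ghost ideal. -/
structure TangibleRetract (R : Type*) [SupertropicalSemiring R] where
  toFun : R → R
  mem_T0 : ∀ a : R, tangible0 (toFun a)
  id_on_T0 : ∀ a : R, tangible0 a → toFun a = a
  nu_section : ∀ a : R, ghost a → toFun a + toFun a = a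

instance (R : Type*) [SupertropicalSemiring R] :
    CoeFun (TangibleRetract R) (fun _ => R → R) := ⟨TangibleRetract.toFun⟩

/-- The supertropical determinant (permanent) of a square matrix. -/
def per [Semiring R] {n : ℕ} (A : Matrix (Fin n) (Fin n) R) : R :=
  ∑ σ : Equiv.Perm (Fin n), (List.ofFn fun i => A i (σ i)).prod

/-- The supertropical adjoint: the transpose of the matrix of permanental
minors, `adj A i j = |A_{j,i}|`. -/
def adj [Semiring R] {n : ℕ} (A : Matrix (Fin (n + 1)) (Fin (n + 1)) R) :
    Matrix (Fin (n + 1)) (Fin (n + 1)) R :=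
  fun i j => per (A.submatrix j.succAbove i.succAbove)

end ST


theorem STaux_retract {T : Type*} [CommGroup T] (K : Subgroup T)
    (hK : ∀ k ∈ K, ∀ n : ℕ, n ≠ 0 → ∃ s ∈ K, s ^ n = k) :
    ∃ r : T →* T, (∀ t, r t ∈ K) ∧ ∀ k ∈ K, r k = k := by
  classical
  have hsurj : ∀ {n : ℕ}, n ≠ 0 →
      Function.Surjective (fun a : Additive K => n • a) := by
    intro n hn a
    obtain ⟨s, hs, h⟩ := hK (Additive.toMul a).1 (Additive.toMul a).2 n hn
    refine ⟨Additive.ofMul ⟨s, hs⟩, ?_⟩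
    apply Additive.toMul.injective
    apply Subtype.ext
    simpa using h
  letI : DivisibleBy (Additive K) ℕ := divisibleByOfSMulRightSurj _ _ hsurj
  letI : DivisibleBy (Additive K) ℤ := AddGroup.divisibleByIntOfDivisibleByNat _
  obtain ⟨h, hh⟩ := Module.Baer.extension_property (Module.Baer.of_divisible (Additive K))
    (AddMonoidHom.toIntLinearMap (MonoidHom.toAdditive K.subtype))
    (fun a b hab => Additive.toMul.injective (Subtype.ext hab)) LinearMap.id
  refine ⟨K.subtype.comp (MonoidHom.toAdditive.symm h.toAddMonoidHom), ?_, ?_⟩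
  · intro t
    exact (Additive.toMul (h (Additive.ofMul t))).2
  · intro k hk
    have := LinearMap.congr_fun hh (Additive.ofMul ⟨k, hk⟩)
    exact congrArg (fun x : Additive K => ((Additive.toMul x : K) : T)) this

section
variable {F : Type*} [SupertropicalSemifield F]

theorem STaux_nu_mul (a b : F) : (a + a) * (b + b) = a * b + a * b := by
  rw [add_mul, mul_add]
  exact SupertropicalSemiring.nu_idem _

theorem STaux_nu_ghost {g : F} (hg : ST.ghost g) : g + g = g := by
  by_cases h : g = 0
  · simp [h]
  · obtain ⟨t, -, rfl⟩ := SupertropicalDomain.nu_onto hg h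
    exact SupertropicalSemiring.nu_idem _

theorem STaux_unit_tangible {a b : F} (h : a * b = 1) : ¬ ST.ghost a := fun ha =>
  SupertropicalDomain.one_tangible (R := F) (h ▸ SupertropicalSemiring.ghost_mul_right b ha)

theorem STaux_nu_one_ne : (1 : F) + 1 ≠ 0 := by
  intro h
  have h1 : (1 : F) + 0 = 1 + 1 := SupertropicalSemiring.add_eq_nu (by simp [h])
  apply SupertropicalDomain.one_tangible (R := F)
  rw [add_zero, h] at h1
  rw [h1]; exact SupertropicalSemiring.ghost_zero

theorem STaux_nu_unit_ne {a b : F} (hab : a * b = 1) : a + a ≠ 0 := by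
  intro h
  apply STaux_nu_one_ne (F := F)
  rw [← hab, ← add_mul, h, zero_mul]

theorem STaux_nu_pow (a : F) (n : ℕ) (hn : n ≠ 0) : (a + a) ^ n = a ^ n + a ^ n := by
  induction n with
  | zero => exact absurd rfl hn
  | succ k ih =>
    by_cases hk : k = 0
    · simp [hk]
    · rw [pow_succ, ih hk, STaux_nu_mul, pow_succ]

/-- torsion-freeness of the ghost group -/
theorem STaux_torsion (a : F) (n : ℕ) (hn : n ≠ 0) (h : a ^ n + a ^ n = 1 + 1) :
    a + a = 1 + 1 := by
  by_contra hne
  have hG := SupertropicalSemiring.nu_idem (R := F) a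
  have hE := SupertropicalSemiring.nu_idem (R := F) 1
  have hge : (a + a) * (1 + 1) = a + a := by rw [STaux_nu_mul, mul_one]
  have hpow := (STaux_nu_pow a n hn).trans h
  clear h
  generalize a + a = g at *
  generalize (1 : F) + 1 = e at *
  obtain ⟨m, rfl⟩ := Nat.exists_eq_succ_of_ne_zero hn
  have hmul : ∀ k : ℕ, g * g ^ (k + 1) = g ^ (k + 2) := fun k => (pow_succ' g (k + 1)).symm
  rcases SupertropicalSemiring.add_cases (a := e) (b := g)
    (by rw [hE, hG]; exact fun h => hne h.symm) with h1 | h1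
  · have h2 : g + g * g = g := by
      have := congrArg (g * ·) h1
      simpa only [mul_add, hge] using this
    have key : ∀ k : ℕ, g ^ (k + 1) + g = g := by
      intro k
      induction k with
      | zero => simpa using hG
      | succ k ih =>
        have h3 := congrArg (g * ·) ih
        simp only [mul_add, hmul] at h3
        calc g ^ (k + 2) + g = g ^ (k + 2) + (g + g * g) := by rw [h2]
          _ = (g ^ (k + 2) + g * g) + g := by rw [add_comm g, add_assoc]
          _ = g := by rw [h3, add_comm, h2]
    have h4 := key m
    rw [hpow] at h4
    exact hne (h4.symm.trans h1)
  · have h2 : g + g * g = g * g := by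
      have := congrArg (g * ·) h1
      simpa only [mul_add, hge] using this
    have key : ∀ k : ℕ, g ^ (k + 1) + g = g ^ (k + 1) := by
      intro k
      induction k with
      | zero => simpa using hG
      | succ k ih =>
        have h3 := congrArg (g * ·) ih
        simp only [mul_add, hmul] at h3
        calc g ^ (k + 2) + g = (g ^ (k + 2) + g * g) + g := by rw [h3]
          _ = g ^ (k + 2) + (g + g * g) := by rw [add_comm g, add_assoc]
          _ = g ^ (k + 2) := by rw [h2, h3]
    have h4 := key m
    rw [hpow] at h4
    exact hne (h1.symm.trans h4)

/-- A semifield is a commutative monoid. -/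
abbrev STaux_commMonoid (F : Type*) [SupertropicalSemifield F] : CommMonoid F :=
  { (inferInstance : Monoid F) with mul_comm := SupertropicalDomain.mul_comm }

theorem STaux_section (hdiv : ∀ (a : F) (k : ℕ), 1 ≤ k → ∃ b : F, b ^ k = a) :
    ∃ s : Fˣ →* Fˣ, (∀ t : Fˣ, (s t : F) + s t = (t : F) + t) ∧
      ∀ t u : Fˣ, (t : F) + t = (u : F) + u → s t = s u := by
  letI : CommMonoid F := STaux_commMonoid F
  let K : Subgroup Fˣ :=
    { carrier := {u | (u : F) + u = 1 + 1}
      one_mem' := by simp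
      mul_mem' := by
        intro a b ha hb
        simp only [Set.mem_ofPred_eq, Units.val_mul] at *
        rw [← STaux_nu_mul, ha, hb, STaux_nu_mul, mul_one]
      inv_mem' := by
        intro a ha
        simp only [Set.mem_ofPred_eq] at *
        have h := STaux_nu_mul (a : F) (↑a⁻¹ : F)
        rw [ha, STaux_nu_mul, Units.mul_inv, one_mul] at h
        exact h }
  have hmem : ∀ u : Fˣ, u ∈ K ↔ (u : F) + u = 1 + 1 := fun u => Iff.rfl
  obtain ⟨r, hr, hrK⟩ := STaux_retract K (by
    intro k hk n hn
    obtain ⟨b, hb⟩ := hdiv (k : F) n (Nat.one_le_iff_ne_zero.2 hn)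
    have hu : IsUnit b := (isUnit_pow_iff hn).1 (hb ▸ k.isUnit)
    obtain ⟨u, rfl⟩ := hu
    refine ⟨u, ?_, Units.ext (by simpa using hb)⟩
    rw [hmem] at hk ⊢
    exact STaux_torsion _ n hn (by rw [hb]; exact hk))
  refine ⟨{ toFun := fun t => t * (r t)⁻¹, map_one' := by simp, map_mul' := ?_ }, ?_, ?_⟩
  · intro x y
    rw [map_mul, mul_inv, mul_mul_mul_comm]
  · intro t
    have := (hmem _).1 (K.inv_mem (hr t))
    simp only [MonoidHom.coe_mk, OneHom.coe_mk, Units.val_mul]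
    rw [← STaux_nu_mul, this, STaux_nu_mul, mul_one]
  · intro t u htu
    have h1 : t * u⁻¹ ∈ K := by
      rw [hmem, Units.val_mul, ← STaux_nu_mul, htu, STaux_nu_mul, Units.mul_inv]
    have h2 := hrK _ h1
    rw [map_mul, map_inv] at h2
    simp only [MonoidHom.coe_mk, OneHom.coe_mk]
    have h3 : t = r t * (r u)⁻¹ * u := by rw [h2]; group
    calc t * (r t)⁻¹ = r t * (r u)⁻¹ * u * (r t)⁻¹ := by rw [← h3]
      _ = u * (r u)⁻¹ := by
        rw [mul_assoc (r t), mul_comm (r t), mul_assoc, mul_inv_cancel, mul_one, mul_comm]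
end

/-- If `F` is a divisibly closed supertropical semifield, then
there is a tangible retract function whose restriction to the nonzero ghosts
is a multiplicative group homomorphism into the tangibles. -/
theorem exists_multiplicative_tangible_retract {F : Type*} [SupertropicalSemifield F]
    (hdiv : ∀ (a : F) (k : ℕ), 1 ≤ k → ∃ b : F, b ^ k = a) :
    ∃ f : ST.TangibleRetract F,
      ∀ g h : F, ST.ghost g → ST.ghost h → g ≠ 0 → h ≠ 0 →
        f (g * h) = f g * f h := by
  classical
  obtain ⟨s, hs, hs'⟩ := STaux_section hdiv
  have hex : ∀ g : F, ¬ ST.tangible0 g → ∃ t : Fˣ, (t : F) + t = g := by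
    intro g hg
    simp only [ST.tangible0, not_or, not_not] at hg
    obtain ⟨t, ht, htg⟩ := SupertropicalDomain.nu_onto hg.2 hg.1
    obtain ⟨b, -, hb⟩ := SupertropicalSemifield.tangible_inv ht
    exact ⟨⟨t, b, hb, by rw [SupertropicalDomain.mul_comm]; exact hb⟩, htg⟩
  have htan : ∀ u : Fˣ, ST.tangible (u : F) := fun u => STaux_unit_tangible u.mul_inv
  choose! c hc using hex
  have hnot : ∀ {g : F}, ST.ghost g → g ≠ 0 → ¬ ST.tangible0 g := by
    rintro g hg h0 (h | h)
    · exact h0 h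
    · exact h hg
  refine ⟨⟨fun g => if ST.tangible0 g then g else (s (c g) : F), ?_, ?_, ?_⟩, ?_⟩
  · intro a
    try dsimp only
    split_ifs with h
    · exact h
    · exact Or.inr (htan _)
  · intro a h
    exact if_pos h
  · intro a ha
    try dsimp only
    split_ifs with h
    · exact STaux_nu_ghost ha
    · rw [hs, hc a h]
  · intro g h hg hh g0 h0
    have ng := hnot hg g0
    have nh := hnot hh h0
    have hgh : g * h = ((c g * c h : Fˣ) : F) + ((c g * c h : Fˣ) : F) := by
      rw [Units.val_mul, ← STaux_nu_mul, hc g ng, hc h nh]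
    have ngh : ¬ ST.tangible0 (g * h) := hnot (SupertropicalSemiring.ghost_mul_left g hh)
      (hgh ▸ STaux_nu_unit_ne (c g * c h).mul_inv)
    try dsimp only
    rw [if_neg ng, if_neg nh, if_neg ngh, ← Units.val_mul, ← map_mul]
    exact congrArg _ (hs' _ _ ((hc _ ngh).trans hgh))
end

section
/- Let A be a quasi-invertible matrix (|A| invertible tangible) over a supertropical semifield. Then A·A^∇ = A·A^ν̂∇, where A^∇ = |A|^{-1} adj(A) and A^ν̂∇ = |A|^{-1} ν̂(adj(A)); moreover this common product I_A is a quasi-identity matrix: it is nonsingular, multiplicatively idempotent, equals I on the diagonal, and has all off-diagonal entries in the ghost ideal. -/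
namespace QI
section basic
variable {R : Type*} [SupertropicalSemifield R]

@[reducible] def commSemi (R : Type*) [SupertropicalSemifield R] : CommSemiring R :=
  { (inferInstance : Semiring R) with mul_comm := SupertropicalDomain.mul_comm }

attribute [local instance] commSemi

local infix:50 "≼" => ST.nuLe

theorem le_rfl' (a : R) : a ≼ a := SupertropicalSemiring.nu_idem a

theorem le_of_nu {a b : R} (h : a + a = b + b) : a ≼ b := by
  unfold ST.nuLe; rw [h]; exact SupertropicalSemiring.nu_idem b

theorem le_tr {a b c : R} (h1 : a ≼ b) (h2 : b ≼ c) : a ≼ c := by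
  unfold ST.nuLe at *
  rw [← h2, ← add_assoc, h1]

theorem le_tot (a b : R) : a ≼ b ∨ b ≼ a := by
  unfold ST.nuLe
  by_cases h : a + a = b + b
  · left; rw [h]; exact SupertropicalSemiring.nu_idem b
  · have := SupertropicalSemiring.add_cases (a := a + a) (b := b + b)
      (by rwa [SupertropicalSemiring.nu_idem, SupertropicalSemiring.nu_idem])
    rcases this with h | h
    · right; rw [add_comm]; exact h
    · left; exact h

theorem le_anti {a b : R} (h1 : a ≼ b) (h2 : b ≼ a) : a + a = b + b := by
  unfold ST.nuLe at *
  exact h2.symm.trans ((add_comm _ _).trans h1)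

theorem mul_le {a b : R} (c : R) (h : a ≼ b) : c * a ≼ c * b := by
  unfold ST.nuLe at *
  rw [← mul_add, ← mul_add, ← mul_add, h]

theorem mul_le' {a b : R} (c : R) (h : a ≼ b) : a * c ≼ b * c := by
  rw [mul_comm a, mul_comm b]; exact mul_le c h

theorem mul_le_mul2 {a b c d : R} (h : a ≼ b) (h' : c ≼ d) : a * c ≼ b * d :=
  le_tr (mul_le' c h) (mul_le b h')

theorem le_add_l (a b : R) : a ≼ a + b := by
  unfold ST.nuLe
  have : (a + a) + ((a + b) + (a + b)) = ((a + a) + (a + a)) + (b + b) := by abel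
  rw [this, SupertropicalSemiring.nu_idem]; abel

theorem add_le' {a b c : R} (h1 : a ≼ c) (h2 : b ≼ c) : a + b ≼ c := by
  unfold ST.nuLe at *
  have : (a + b) + (a + b) + (c + c) = (a + a) + ((b + b) + (c + c)) := by abel
  rw [this, h2, h1]

theorem zero_le' (c : R) : (0 : R) ≼ c := by
  unfold ST.nuLe; simp

theorem ghost_nu {g : R} (h : ST.ghost g) : g + g = g := by
  by_cases h0 : g = 0
  · simp [h0]
  · obtain ⟨t, _, rfl⟩ := SupertropicalDomain.nu_onto h h0
    exact SupertropicalSemiring.nu_idem t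

theorem strict_add {a b : R} (h : ¬ a ≼ b) : a + b = a := by
  have h2 : b ≼ a := (le_tot a b).resolve_left h
  have hne : a + a ≠ b + b := fun e => h (le_of_nu e)
  rcases SupertropicalSemiring.add_cases hne with e | e
  · exact e
  · exact absurd (by have := le_add_l a b; rwa [e] at this) h

theorem absorb {g b : R} (hg : ST.ghost g) (h : b ≼ g) : g + b = g := by
  by_cases h2 : g ≼ b
  · rw [SupertropicalSemiring.add_eq_nu (le_anti h2 h), ghost_nu hg]
  · exact strict_add h2

theorem sum_le' {ι : Type*} (s : Finset ι) (r : ι → R) (c : R) (h : ∀ l ∈ s, r l ≼ c) :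
    ∑ l ∈ s, r l ≼ c :=
  Finset.sum_induction r (fun x => x ≼ c) (fun _ _ => add_le') (zero_le' c) h

theorem le_sum' {ι : Type*} [DecidableEq ι] (s : Finset ι) (r : ι → R) {k : ι} (h : k ∈ s) :
    r k ≼ ∑ l ∈ s, r l := by
  rw [← Finset.add_sum_erase s r h]; exact le_add_l _ _

theorem exists_max {ι : Type*} (s : Finset ι) (hs : s.Nonempty) (r : ι → R) :
    ∃ k ∈ s, ∀ l ∈ s, r l ≼ r k := by
  induction hs using Finset.Nonempty.cons_induction with
  | singleton a => exact ⟨a, by simp, by simpa using le_rfl' _⟩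
  | cons a s ha hs ih =>
    obtain ⟨k, hk, hm⟩ := ih
    rcases le_tot (r a) (r k) with h | h
    · refine ⟨k, by simp [hk], fun l hl => ?_⟩
      rcases Finset.mem_cons.1 hl with rfl | hl
      · exact h
      · exact hm l hl
    · refine ⟨a, by simp, fun l hl => ?_⟩
      rcases Finset.mem_cons.1 hl with rfl | hl
      · exact le_rfl' _
      · exact le_tr (hm l hl) h

theorem two_max {ι : Type*} [DecidableEq ι] (s : Finset ι) (r : ι → R) {k m : ι} (hk : k ∈ s)
    (hm : m ∈ s) (hne : m ≠ k) (h : ∀ l ∈ s, r l ≼ r k) (h' : r k ≼ r m) :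
    ∑ l ∈ s, r l = r k + r k := by
  rw [← Finset.add_sum_erase s r hk,
    ← Finset.add_sum_erase (s.erase k) r (Finset.mem_erase.2 ⟨hne, hm⟩), ← add_assoc,
    SupertropicalSemiring.add_eq_nu (le_anti h' (h m hm))]
  refine absorb (SupertropicalSemiring.nu_ghost _) (le_tr ?_ (le_add_l _ _))
  exact sum_le' _ _ _ fun l hl => h l (Finset.mem_of_mem_erase (Finset.mem_of_mem_erase hl))

theorem one_add_ghosts {ι : Type*} [DecidableEq ι] (s : Finset ι) (r : ι → R) {k : ι} (hk : k ∈ s)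
    (h : ∀ l ∈ s, l ≠ k → ¬ r k ≼ r l) : ∑ l ∈ s, r l = r k := by
  rw [← Finset.add_sum_erase s r hk]
  have : ∀ t ⊆ s.erase k, r k + ∑ l ∈ t, r l = r k := by
    intro t
    induction t using Finset.induction_on with
    | empty => simp
    | insert a t ha ih =>
      intro ht
      have ha' := ht (Finset.mem_insert_self a t)
      rw [Finset.sum_insert ha, ← add_assoc,
        strict_add (h a (Finset.mem_of_mem_erase ha') (Finset.ne_of_mem_erase ha'))]
      exact ih fun x hx => ht (Finset.mem_insert_of_mem hx)
  exact this _ subset_rfl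

/-! Permutation weights -/

def wt {n : ℕ} (A : Matrix (Fin n) (Fin n) R) (s : Fin n → Fin n) (σ : Equiv.Perm (Fin n)) : R :=
  ∏ l, A (s l) (σ l)

theorem per_eq {n : ℕ} (A : Matrix (Fin n) (Fin n) R) :
    ST.per A = ∑ σ : Equiv.Perm (Fin n), ∏ l, A l (σ l) := by
  unfold ST.per
  exact Finset.sum_congr rfl fun σ _ => List.prod_ofFn

def ext {n : ℕ} (j k : Fin (n+1)) (τ : Equiv.Perm (Fin n)) : Equiv.Perm (Fin (n+1)) :=
  ((finSuccEquiv' j).trans (Equiv.optionCongr τ)).trans (finSuccEquiv' k).symm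

theorem minor_eq {n : ℕ} (A : Matrix (Fin (n+1)) (Fin (n+1)) R) (i j k : Fin (n+1)) :
    A i k * ST.adj A k j =
      ∑ σ : Equiv.Perm (Fin (n+1)) with σ j = k, wt A (Function.update id j i) σ := by
  unfold ST.adj
  rw [per_eq, Finset.mul_sum]
  refine Finset.sum_bij (fun τ _ => ext j k τ) ?_ ?_ ?_ ?_
  · intro τ _; simp [ext]
  · intro τ _ τ' _ h
    apply Equiv.optionCongr_injective
    ext1 x
    have := congrArg (fun e => finSuccEquiv' k (e ((finSuccEquiv' j).symm x))) h
    simpa [ext] using this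
  · intro σ hσ
    have hσ : σ j = k := by simpa using hσ
    let e : Option (Fin n) ≃ Option (Fin n) := ((finSuccEquiv' j).symm.trans σ).trans (finSuccEquiv' k)
    have he : e none = none := by simp [e, hσ]
    refine ⟨Equiv.removeNone e, Finset.mem_univ _, ?_⟩
    have h2 : Equiv.optionCongr (Equiv.removeNone e) = e := by
      have := map_equiv_removeNone e
      rw [this, he]; simp; rfl
    unfold ext
    rw [h2]
    ext1 x
    simp [e]
  · intro τ _
    unfold wt
    rw [Fin.prod_univ_succAbove _ j]
    simp [ext]

theorem G_eq {n : ℕ} (A : Matrix (Fin (n+1)) (Fin (n+1)) R) (i j : Fin (n+1)) :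
    (A * ST.adj A) i j = ∑ σ : Equiv.Perm (Fin (n+1)), wt A (Function.update id j i) σ := by
  rw [Matrix.mul_apply, Finset.sum_congr rfl fun k _ => minor_eq A i j k]
  exact Finset.sum_fiberwise _ (fun σ : Equiv.Perm (Fin (n+1)) => σ j) _

theorem G_diag {n : ℕ} (A : Matrix (Fin (n+1)) (Fin (n+1)) R) (i : Fin (n+1)) :
    (A * ST.adj A) i i = ST.per A := by
  rw [G_eq, per_eq]
  refine Finset.sum_congr rfl fun σ _ => ?_
  rw [show Function.update id i i = (id : Fin (n+1) → Fin (n+1)) from Function.update_eq_self i id]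
  rfl

/-- Off the diagonal, no column is strictly dominant. -/
theorem no_dom {n : ℕ} (A : Matrix (Fin (n+1)) (Fin (n+1)) R) {i j : Fin (n+1)} (hij : i ≠ j)
    (k : Fin (n+1)) : ∃ m, m ≠ k ∧ A i k * ST.adj A k j ≼ A i m * ST.adj A m j := by
  obtain ⟨σ, hσ, hmax⟩ := exists_max
    (Finset.univ.filter fun σ : Equiv.Perm (Fin (n+1)) => σ j = k)
    ⟨Equiv.swap j k, by simp⟩ (wt A (Function.update id j i))
  have hσ : σ j = k := by simpa using hσ
  refine ⟨σ i, fun h => hij (σ.injective (h.trans hσ.symm)), ?_⟩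
  rw [minor_eq, minor_eq]
  refine le_tr (sum_le' _ _ _ hmax) ?_
  have : wt A (Function.update id j i) σ = wt A (Function.update id j i) (σ * Equiv.swap i j) := by
    unfold wt
    rw [← Equiv.prod_comp (Equiv.swap i j)]
    refine Finset.prod_congr rfl fun l _ => ?_
    congr 1
    by_cases h1 : l = i
    · subst h1; simp [hij]
    · by_cases h2 : l = j
      · subst h2; simp [hij]
      · simp [Equiv.swap_apply_of_ne_of_ne h1 h2]
  rw [this]
  exact le_sum' _ _ (by simp)

/-! The exchange argument -/

theorem split {n : ℕ} (θ : Equiv.Perm (Fin n)) {j k : Fin n} (hjk : j ≠ k) :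
    ∃ Z : Finset (Fin n), k ∈ Z ∧ j ∉ Z ∧
      ((∀ x ∈ Z, θ x ∈ Z) ∨ (∀ x ∈ Z, Equiv.swap j k (θ x) ∈ Z)) := by
  classical
  by_cases h : ∃ m : ℕ, (θ ^ m) k = j
  · have hm := Nat.find_spec h
    have hmin := fun a => Nat.find_min h (m := a)
    generalize Nat.find h = m at hm hmin
    have hm0 : m ≠ 0 := by rintro rfl; exact hjk (by simpa using hm.symm)
    refine ⟨(Finset.range m).image (fun a => (θ ^ a) k), ?_, ?_, Or.inr ?_⟩
    · exact Finset.mem_image.2 ⟨0, by simp; omega, by simp⟩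
    · intro hj
      obtain ⟨a, ha, e⟩ := Finset.mem_image.1 hj
      exact hmin a (Finset.mem_range.1 ha) e
    · intro x hx
      obtain ⟨a, ha, rfl⟩ := Finset.mem_image.1 hx
      have ha := Finset.mem_range.1 ha
      have e : θ ((θ ^ a) k) = (θ ^ (a+1)) k := by rw [pow_succ']; rfl
      simp only [e]
      rcases Nat.lt_or_ge (a+1) m with h1 | h1
      · have hj : (θ ^ (a+1)) k ≠ j := hmin _ h1
        have hk : (θ ^ (a+1)) k ≠ k := by
          intro hk
          refine hmin (m - (a+1)) (by omega) ?_
          have : m = (m - (a+1)) + (a+1) := by omega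
          rw [this, pow_add, Equiv.Perm.mul_apply, hk] at hm
          exact hm
        rw [Equiv.swap_apply_of_ne_of_ne hj hk]
        exact Finset.mem_image.2 ⟨a+1, by simpa using h1, rfl⟩
      · have : a + 1 = m := by omega
        rw [this, hm, Equiv.swap_apply_left]
        exact Finset.mem_image.2 ⟨0, by simp; omega, by simp⟩
  · refine ⟨Finset.univ.filter fun x => ∃ m : ℕ, (θ ^ m) k = x, ?_, ?_, Or.inl ?_⟩
    · simp; exact ⟨0, rfl⟩
    · simpa using h
    · simp only [Finset.mem_filter, Finset.mem_univ, true_and]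
      rintro _ ⟨m, rfl⟩
      exact ⟨m+1, by rw [pow_succ']; rfl⟩

/-- Glue two permutations that agree setwise on `Z`. -/
theorem glue {n : ℕ} (σ τ : Equiv.Perm (Fin n)) (Z : Finset (Fin n))
    (h : ∀ x, x ∈ Z ↔ τ.symm (σ x) ∈ Z) :
    ∃ ρ : Equiv.Perm (Fin n), ∀ x, ρ x = if x ∈ Z then τ x else σ x := by
  have hinj : Function.Injective (fun x => if x ∈ Z then τ x else σ x) := by
    intro x y hxy
    by_cases hx : x ∈ Z <;> by_cases hy : y ∈ Z <;> simp only [hx, hy, if_true, if_false] at hxy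
    · exact τ.injective hxy
    · exact absurd ((h y).2 (by rw [← hxy]; simpa using hx)) hy
    · exact absurd ((h x).2 (by rw [hxy]; simpa using hy)) hx
    · exact σ.injective hxy
  exact ⟨Equiv.ofBijective _ (Finite.injective_iff_bijective.1 hinj), fun x => rfl⟩

theorem exchange {n : ℕ} (A : Matrix (Fin n) (Fin n) R) {i j k : Fin n} (hjk : j ≠ k)
    (σ τ : Equiv.Perm (Fin n)) : ∃ ρ π : Equiv.Perm (Fin n), ρ ≠ π ∧
      wt A (Function.update id k i) σ * wt A (Function.update id j k) τ =
        wt A id ρ * wt A (Function.update id j i) π := by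
  obtain ⟨Z, hk, hj, hZ⟩ := split (τ.symm * σ : Equiv.Perm (Fin n)) hjk
  have hsw : wt A (Function.update id j k) (τ * Equiv.swap j k)
      = wt A (Function.update id j k) τ := by
    unfold wt
    rw [← Equiv.prod_comp (Equiv.swap j k)]
    refine Finset.prod_congr rfl fun l _ => ?_
    by_cases h1 : l = j
    · subst h1; simp [hjk.symm]
    · by_cases h2 : l = k
      · subst h2; simp [hjk.symm]
      · simp [Equiv.swap_apply_of_ne_of_ne h1 h2]
  obtain ⟨τ', hτ', hZ'⟩ : ∃ τ' : Equiv.Perm (Fin n),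
      wt A (Function.update id j k) τ' = wt A (Function.update id j k) τ ∧
      ∀ x ∈ Z, τ'.symm (σ x) ∈ Z := by
    rcases hZ with h | h
    · exact ⟨τ, rfl, h⟩
    · refine ⟨τ * Equiv.swap j k, hsw, fun x hx => ?_⟩
      have := h x hx
      simpa [Equiv.Perm.mul_def] using this
  rw [← hτ']
  clear hsw hZ hτ' τ
  have hiff : ∀ x, x ∈ Z ↔ τ'.symm (σ x) ∈ Z := by
    intro x
    refine ⟨hZ' x, fun hx => ?_⟩
    have hinj : Function.Injective (fun x => τ'.symm (σ x)) :=
      τ'.symm.injective.comp σ.injective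
    have hsub : Z.image (fun x => τ'.symm (σ x)) ⊆ Z := by
      intro y hy
      obtain ⟨x, hx, rfl⟩ := Finset.mem_image.1 hy
      exact hZ' x hx
    have heq := Finset.eq_of_subset_of_card_le hsub (by rw [Finset.card_image_of_injective _ hinj])
    rw [← heq] at hx
    obtain ⟨y, hy, e⟩ := Finset.mem_image.1 hx
    rwa [← hinj e]
  have hiff2 : ∀ x, x ∈ Z ↔ σ.symm (τ' x) ∈ Z := by
    intro x
    have := hiff (σ.symm (τ' x))
    simpa using this.symm
  obtain ⟨ρ, hρ⟩ := glue σ τ' Z hiff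
  obtain ⟨π, hπ⟩ := glue τ' σ Z hiff2
  refine ⟨ρ, π * Equiv.swap j k, ?_, ?_⟩
  · intro e
    have := congrArg (fun e : Equiv.Perm (Fin n) => e j) e
    simp [hρ, hπ, hj, hk] at this
    exact hjk this
  · have h2 : wt A (Function.update id j i) (π * Equiv.swap j k) =
        ∏ l, A (Function.update (Function.update id k i) j k l) (π l) := by
      unfold wt
      rw [← Equiv.prod_comp (Equiv.swap j k)]
      refine Finset.prod_congr rfl fun l _ => ?_
      by_cases h1 : l = j
      · subst h1; simp [hjk.symm]
      · by_cases h2 : l = k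
        · subst h2; simp [hjk.symm]
        · simp [Equiv.swap_apply_of_ne_of_ne h1 h2, h1, h2]
    rw [h2]
    unfold wt
    rw [← Finset.prod_mul_distrib, ← Finset.prod_mul_distrib]
    refine Finset.prod_congr rfl fun l _ => ?_
    rw [hρ, hπ]
    by_cases hl : l ∈ Z
    · have : l ≠ j := by rintro rfl; exact hj hl
      simp [hl, this, mul_comm]
    · have : l ≠ k := by rintro rfl; exact hl hk
      simp only [hl, if_false]
      by_cases h1 : l = j
      · subst h1; simp [hjk]
      · simp [h1, this]

theorem wt_le_per {n : ℕ} (A : Matrix (Fin n) (Fin n) R) (σ : Equiv.Perm (Fin n)) :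
    wt A id σ ≼ ST.per A := by
  rw [per_eq]
  exact le_sum' Finset.univ (fun σ => wt A id σ) (Finset.mem_univ σ)

theorem uniq {n : ℕ} (A : Matrix (Fin n) (Fin n) R) (hA : ST.tangible (ST.per A))
    {ρ π : Equiv.Perm (Fin n)} (hne : ρ ≠ π) (h1 : ST.per A ≼ wt A id ρ)
    (h2 : ST.per A ≼ wt A id π) : False := by
  apply hA
  have := two_max Finset.univ (fun σ => wt A id σ) (Finset.mem_univ π) (Finset.mem_univ ρ) hne
    (fun l _ => le_tr (wt_le_per A l) h2) (le_tr (wt_le_per A π) h1)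
  rw [per_eq]
  exact (congrArg ST.ghost this).mpr (SupertropicalSemiring.nu_ghost _)

theorem G_trans {n : ℕ} (A : Matrix (Fin (n+1)) (Fin (n+1)) R) {i j k : Fin (n+1)} :
    (A * ST.adj A) i k * (A * ST.adj A) k j ≼ ST.per A * (A * ST.adj A) i j := by
  by_cases hjk : j = k
  · subst hjk; rw [G_diag, mul_comm]; exact le_rfl' _
  · rw [G_eq, G_eq, Finset.sum_mul_sum]
    refine sum_le' _ _ _ fun σ _ => sum_le' _ _ _ fun τ _ => ?_
    obtain ⟨ρ, π, _, e⟩ := exchange A (i := i) hjk σ τ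
    rw [e, G_eq]
    exact mul_le_mul2 (wt_le_per A ρ) (le_sum' _ _ (Finset.mem_univ π))

theorem G_strict {n : ℕ} (A : Matrix (Fin (n+1)) (Fin (n+1)) R) (hA : ST.tangible (ST.per A))
    {u : R} (hu : ST.per A * u = 1) {i k : Fin (n+1)} (hik : i ≠ k) :
    ¬ ST.per A * ST.per A ≼ (A * ST.adj A) i k * (A * ST.adj A) k i := by
  rw [G_eq, G_eq, Finset.sum_mul_sum, ← Finset.sum_product']
  intro h
  obtain ⟨⟨σ, τ⟩, _, hm⟩ := exists_max
    ((Finset.univ : Finset (Equiv.Perm (Fin (n+1)))) ×ˢ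
      (Finset.univ : Finset (Equiv.Perm (Fin (n+1))))) ⟨(1, 1), by simp⟩
    (fun p => wt A (Function.update id k i) p.1 * wt A (Function.update id i k) p.2)
  have h := le_tr h (sum_le' _ _ _ hm)
  obtain ⟨ρ, π, hne, e⟩ := exchange A (i := i) hik σ τ
  simp only at h
  rw [e] at h
  have hid : Function.update id i i = (id : Fin (n+1) → Fin (n+1)) := Function.update_eq_self i id
  rw [hid] at h
  have canc : ∀ x, ST.per A * ST.per A ≼ ST.per A * x → ST.per A ≼ x := by
    intro x hx
    have := mul_le u hx
    rwa [← mul_assoc, ← mul_assoc, mul_comm u, hu, one_mul, one_mul] at this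
  refine uniq A hA hne (canc _ (le_tr h ?_)) (canc _ (le_tr h ?_))
  · rw [mul_comm]; exact mul_le' _ (wt_le_per A π)
  · exact mul_le' _ (wt_le_per A ρ)

/-- Permanent of a matrix with the closure properties. -/
theorem perm_strict {n : ℕ} (B : Matrix (Fin n) (Fin n) R) (hd : ∀ i, B i i = 1)
    (ht : ∀ i j k, B i k * B k j ≼ B i j) (hs : ∀ i k, i ≠ k → ¬ (1 : R) ≼ B i k * B k i)
    (σ : Equiv.Perm (Fin n)) (hσ : σ ≠ 1) : ¬ (1 : R) ≼ ∏ l, B l (σ l) := by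
  intro h
  obtain ⟨i, hi⟩ : ∃ i, σ i ≠ i := by
    by_contra hc; push Not at hc; exact hσ (Equiv.ext hc)
  let P : ℕ → Fin n → R := fun a l => ∏ c ∈ Finset.range a, B ((σ ^ c) l) ((σ ^ (c+1)) l)
  have hP : ∀ a l, P a l ≼ B l ((σ ^ a) l) := by
    intro a l
    induction a with
    | zero => simp [P, hd]; exact le_rfl' _
    | succ a ih =>
      simp only [P] at ih ⊢
      rw [Finset.prod_range_succ]
      exact le_tr (mul_le' _ ih) (ht _ _ _)
  obtain ⟨M, hM⟩ : ∃ M, orderOf σ = M + 1 := ⟨orderOf σ - 1, by have := orderOf_pos σ; omega⟩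
  have hN : σ ^ (M+1) = 1 := by rw [← hM]; exact pow_orderOf_eq_one σ
  have hprod : ∏ l, P (M+1) l = (∏ l, B l (σ l)) ^ (M+1) := by
    simp only [P]
    rw [Finset.prod_comm, Finset.prod_congr rfl (g := fun _ => ∏ l, B l (σ l)),
      Finset.prod_const, Finset.card_range]
    intro c _
    rw [← Equiv.prod_comp (σ ^ c) (fun l => B l (σ l))]
    refine Finset.prod_congr rfl fun l _ => ?_
    rw [pow_succ']; rfl
  have hpow : ∀ m : ℕ, (1 : R) ≼ (∏ l, B l (σ l)) ^ m := by
    intro m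
    induction m with
    | zero => rw [pow_zero]; exact le_rfl' _
    | succ m ih =>
      rw [pow_succ]
      have := mul_le_mul2 ih h
      rwa [one_mul] at this
  have h1 : ∀ l, P (M+1) l ≼ 1 := by
    intro l
    have := hP (M+1) l
    rw [hN] at this
    simpa [hd] using this
  have h2 : ∏ l ∈ Finset.univ.erase i, P (M+1) l ≼ 1 := by
    refine Finset.prod_induction _ (fun x => x ≼ (1 : R)) (fun a b ha hb => ?_) (le_rfl' _)
      (fun l _ => h1 l)
    have := mul_le_mul2 ha hb
    rwa [one_mul] at this
  have h3 : (1 : R) ≼ P (M+1) i := by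
    have h4 := hpow (M+1)
    rw [← hprod, ← Finset.mul_prod_erase _ _ (Finset.mem_univ i)] at h4
    have := le_tr h4 (mul_le _ h2)
    rwa [mul_one] at this
  have h5 : P (M+1) i = P M (σ i) * B i (σ i) := by
    simp only [P]
    rw [Finset.prod_range_succ']
    congr 1
  refine hs i (σ i) (Ne.symm hi) (le_tr h3 ?_)
  rw [h5, mul_comm]
  refine mul_le _ ?_
  have := hP M (σ i)
  have e : (σ ^ M) (σ i) = i := by
    have : (σ ^ (M+1)) i = i := by rw [hN]; rfl
    rwa [pow_succ] at this
  rwa [e] at this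

theorem retract_eq (f : ST.TangibleRetract R) (x : R) : x = f x ∨ x = f x + f x := by
  by_cases h : ST.ghost x
  · right; exact (f.nu_section x h).symm
  · left; exact (f.id_on_T0 x (Or.inr h)).symm

theorem retract_nu (f : ST.TangibleRetract R) (x : R) : x + x = f x + f x := by
  rcases retract_eq f x with h | h
  · rw [← h]
  · have : x + x = (f x + f x) + (f x + f x) := by rw [← h]
    rw [this]; exact SupertropicalSemiring.nu_idem _

theorem retract_gs (f : ST.TangibleRetract R) (x : R) : ∃ c, ST.ghost c ∧ x = f x + c := by
  rcases retract_eq f x with h | h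
  · exact ⟨0, SupertropicalSemiring.ghost_zero, by rw [add_zero]; exact h⟩
  · refine ⟨f x + f x, SupertropicalSemiring.nu_ghost _, ?_⟩
    rw [add_comm (f x), absorb (SupertropicalSemiring.nu_ghost _) (le_add_l _ _)]
    exact h

theorem tangible_gs {x y c : R} (hx : ST.tangible x) (hc : ST.ghost c) (h : x = y + c) : x = y := by
  by_cases e : y ≼ c
  · rw [add_comm, absorb hc e] at h
    exact absurd (h ▸ hc) hx
  · rw [strict_add e] at h; exact h

theorem ghost_sum {n : ℕ} (r : Fin (n+1) → R) (h : ∀ k, ∃ m, m ≠ k ∧ r k ≼ r m) :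
    ST.ghost (∑ k, r k) := by
  obtain ⟨k, hk, hm⟩ := exists_max Finset.univ Finset.univ_nonempty r
  obtain ⟨m, hmk, hle⟩ := h k
  rw [two_max Finset.univ r hk (Finset.mem_univ m) hmk hm hle]
  exact SupertropicalSemiring.nu_ghost _

theorem main_sub (f : ST.TangibleRetract R) {n : ℕ} (A : Matrix (Fin (n + 1)) (Fin (n + 1)) R)
    (hA : ST.tangible (ST.per A)) :
    A * ST.adj A = A * (ST.adj A).map f ∧
    (∀ i j, i ≠ j → ST.ghost ((A * ST.adj A) i j)) := by
  have hg : ∀ i j, i ≠ j → ST.ghost ((A * ST.adj A) i j) := by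
    intro i j hij
    rw [Matrix.mul_apply]
    exact ghost_sum _ (no_dom A hij)
  refine ⟨?_, hg⟩
  ext i j
  by_cases hij : i = j
  · subst hij
    choose c hc hfc using fun k => retract_gs f (ST.adj A k i)
    have ht : ST.tangible ((A * ST.adj A) i i) := by rw [G_diag]; exact hA
    refine tangible_gs (c := ∑ k, A i k * c k) ht ?_ ?_
    · exact Finset.sum_induction _ (fun x => ST.ghost x)
        (fun _ _ => SupertropicalSemiring.ghost_add) SupertropicalSemiring.ghost_zero
        (fun k _ => SupertropicalSemiring.ghost_mul_left _ (hc k))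
    · rw [Matrix.mul_apply, Matrix.mul_apply, ← Finset.sum_add_distrib]
      refine Finset.sum_congr rfl fun k _ => ?_
      rw [← mul_add, Matrix.map_apply, ← hfc]
  · have hnu : ∀ k, A i k * ST.adj A k j + A i k * ST.adj A k j
        = A i k * f (ST.adj A k j) + A i k * f (ST.adj A k j) := by
      intro k
      rw [← mul_add, ← mul_add, retract_nu f]
    have h2 : ST.ghost ((A * (ST.adj A).map f) i j) := by
      rw [Matrix.mul_apply]
      refine ghost_sum _ fun k => ?_
      obtain ⟨m, hm, hle⟩ := no_dom A hij k
      exact ⟨m, hm, le_tr (le_of_nu (hnu k).symm) (le_tr hle (le_of_nu (hnu m)))⟩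
    rw [← ghost_nu h2, ← ghost_nu (hg i j hij), Matrix.mul_apply, Matrix.mul_apply,
      ← Finset.sum_add_distrib, ← Finset.sum_add_distrib]
    exact Finset.sum_congr rfl fun k _ => hnu k

theorem mul_smul' {n : ℕ} (A C : Matrix (Fin n) (Fin n) R) (u : R) : A * (u • C) = u • (A * C) :=
  Matrix.mul_smul A u C

theorem main {n : ℕ} (f : ST.TangibleRetract R) (A : Matrix (Fin (n + 1)) (Fin (n + 1)) R)
    (hA : ST.tangible (ST.per A)) (u : R) (hu : ST.per A * u = 1) :
    A * (u • ST.adj A) = A * (u • (ST.adj A).map f) ∧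
    (ST.tangible (ST.per (A * (u • ST.adj A))) ∧
      ∃ w : R, ST.per (A * (u • ST.adj A)) * w = 1) ∧
    (A * (u • ST.adj A)) * (A * (u • ST.adj A)) = A * (u • ST.adj A) ∧
    (∀ i, (A * (u • ST.adj A)) i i = 1) ∧
    (∀ i j, i ≠ j → ST.ghost ((A * (u • ST.adj A)) i j)) := by
  obtain ⟨hm1, hm2⟩ := main_sub f A hA
  rw [mul_smul', mul_smul', ← hm1]
  set B := u • (A * ST.adj A) with hB
  have hBe : ∀ i j, B i j = u * (A * ST.adj A) i j := fun i j => rfl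
  have hd : ∀ i, B i i = 1 := fun i => by rw [hBe, G_diag, mul_comm]; exact hu
  have hgh : ∀ i j, i ≠ j → ST.ghost (B i j) := fun i j hij => by
    rw [hBe]; exact SupertropicalSemiring.ghost_mul_left _ (hm2 i j hij)
  have hBB : ∀ i j k, B i k * B k j = (u * u) * ((A * ST.adj A) i k * (A * ST.adj A) k j) :=
    fun i j k => by rw [hBe, hBe]; ring
  have ht : ∀ i j k, B i k * B k j ≼ B i j := by
    intro i j k
    have := mul_le (u * u) (G_trans A (i := i) (j := j) (k := k))
    rw [← hBB] at this
    have e : u * u * (ST.per A * (A * ST.adj A) i j) = B i j := by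
      calc _ = (ST.per A * u) * (u * (A * ST.adj A) i j) := by ring
        _ = _ := by rw [hu, one_mul]; rfl
    rwa [e] at this
  have hs : ∀ i k, i ≠ k → ¬ (1 : R) ≼ B i k * B k i := by
    intro i k hik h
    apply G_strict A hA hu hik
    have := mul_le (ST.per A * ST.per A) h
    rw [hBB, mul_one] at this
    have e : ST.per A * ST.per A * (u * u * ((A * ST.adj A) i k * (A * ST.adj A) k i))
        = (A * ST.adj A) i k * (A * ST.adj A) k i := by
      calc _ = (ST.per A * u) * (ST.per A * u) * ((A * ST.adj A) i k * (A * ST.adj A) k i) := by ring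
        _ = _ := by rw [hu, one_mul, one_mul]
    rwa [e] at this
  have hper : ST.per B = 1 := by
    rw [per_eq, one_add_ghosts Finset.univ _ (Finset.mem_univ 1)]
    · simp [hd]
    · intro σ _ hσ
      have := perm_strict B hd ht hs σ hσ
      simpa [hd] using this
  refine ⟨rfl, ?_, ?_, hd, hgh⟩
  · rw [hper]
    exact ⟨SupertropicalDomain.one_tangible, 1, one_mul 1⟩
  · ext i j
    rw [Matrix.mul_apply]
    by_cases hij : i = j
    · subst hij
      rw [one_add_ghosts Finset.univ _ (Finset.mem_univ i), hd, one_mul]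
      intro k _ hk
      rw [hd, one_mul]
      exact hs i k hk.symm
    · have e1 : B i i * B i j = B i j := by rw [hd, one_mul]
      have e2 : B i j * B j j = B i j := by rw [hd, mul_one]
      rw [two_max Finset.univ (fun k => B i k * B k j) (Finset.mem_univ i) (Finset.mem_univ j)
        (Ne.symm hij)]
      · simp only [e1]; exact ghost_nu (hgh i j hij)
      · intro l _
        simp only [e1]; exact ht i j l
      · simp only [e1, e2]; exact le_rfl' _

end basic
end QI

/-- For quasi-invertible `A`, `A·A^∇ = A·A^ν̂∇` and this common
product `I_A` is a quasi-identity matrix. -/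
theorem quasi_identity_of_quasi_invertible {R : Type*} [SupertropicalSemifield R]
    (f : ST.TangibleRetract R) {n : ℕ} (A : Matrix (Fin (n + 1)) (Fin (n + 1)) R)
    (hA : ST.tangible (ST.per A)) (u : R) (hu : ST.per A * u = 1) :
    A * (u • ST.adj A) = A * (u • (ST.adj A).map f) ∧
    (ST.tangible (ST.per (A * (u • ST.adj A))) ∧
      ∃ w : R, ST.per (A * (u • ST.adj A)) * w = 1) ∧
    (A * (u • ST.adj A)) * (A * (u • ST.adj A)) = A * (u • ST.adj A) ∧
    (∀ i, (A * (u • ST.adj A)) i i = 1) ∧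
    (∀ i j, i ≠ j → ST.ghost ((A * (u • ST.adj A)) i j)) :=
  QI.main f A hA u hu
end

section
/- If A and B are quasi-invertible matrices over a supertropical semifield with A ≅_ν B (all corresponding entries have the same ν-value), then I_A = I_B, where I_A = A A^∇ is the right quasi-identity of A. -/
namespace STAux

theorem per_eq {S : Type*} [CommSemiring S] {n : ℕ} (A : Matrix (Fin n) (Fin n) S) :
    ST.per A = ∑ σ : Equiv.Perm (Fin n), ∏ i, A i (σ i) := by
  simp [ST.per, List.prod_ofFn]

/-- The permutation sending `j` to `p.1` and acting as `p.2` on the complements. -/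
def ext {n : ℕ} (j : Fin (n + 1)) (p : Fin (n + 1) × Equiv.Perm (Fin n)) :
    Equiv.Perm (Fin (n + 1)) :=
  (finSuccEquiv' j).trans ((Equiv.optionCongr p.2).trans (finSuccEquiv' p.1).symm)

theorem ext_self {n : ℕ} (j : Fin (n + 1)) (p) : ext j p j = p.1 := by
  simp [ext]

theorem ext_succAbove {n : ℕ} (j : Fin (n + 1)) (p) (i : Fin n) :
    ext j p (j.succAbove i) = p.1.succAbove (p.2 i) := by
  simp [ext]

theorem ext_bij {n : ℕ} (j : Fin (n + 1)) : Function.Bijective (ext j) := by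
  rw [Fintype.bijective_iff_injective_and_card]
  constructor
  · rintro ⟨k, τ⟩ ⟨k', τ'⟩ h
    have h1 : k = k' := by
      have := congrArg (fun e => e j) h
      simpa [ext_self] using this
    subst h1
    have h2 : τ = τ' := by
      ext1 i
      have := congrArg (fun e => e (j.succAbove i)) h
      simpa [ext_succAbove] using this
    rw [h2]
  · simp [Fintype.card_perm, Nat.factorial_succ]

theorem laplace {S : Type*} [CommSemiring S] {n : ℕ}
    (A : Matrix (Fin (n + 1)) (Fin (n + 1)) S) (i j : Fin (n + 1)) :
    ∑ k, A i k * ST.adj A k j = ST.per (A.updateRow j (A i)) := by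
  rw [per_eq, ← (ext_bij j).sum_comp, Fintype.sum_prod_type]
  refine Finset.sum_congr rfl fun k _ => ?_
  rw [ST.adj, per_eq, Finset.mul_sum]
  refine Finset.sum_congr rfl fun τ _ => ?_
  rw [Fin.prod_univ_succAbove _ j]
  simp [ext_self, ext_succAbove, Matrix.updateRow_ne, Fin.succAbove_ne]

theorem per_double {S : Type*} [CommSemiring S] {n : ℕ}
    (A : Matrix (Fin n) (Fin n) S) (i j : Fin n) (hij : i ≠ j) (h : A i = A j) :
    ∃ x, ST.per A = x + x := by
  refine ⟨∑ σ : Equiv.Perm (Fin n) with σ i < σ j, ∏ k, A k (σ k), ?_⟩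
  rw [per_eq, ← Finset.sum_filter_add_sum_filter_not _ (fun σ => σ i < σ j)]
  congr 1
  refine Finset.sum_bij (fun σ _ => σ * Equiv.swap i j) ?_ ?_ ?_ ?_
  · intro σ hσ
    have : σ i ≠ σ j := fun e => hij (σ.injective e)
    simp at hσ ⊢
    omega
  · intro a _ b _ hab
    exact mul_right_cancel hab
  · intro σ hσ
    refine ⟨σ * Equiv.swap i j, ?_, by simp [mul_assoc]⟩
    simp at hσ ⊢
    exact hσ.le
  · intro σ _
    rw [← Equiv.prod_comp (Equiv.swap i j)]
    refine Finset.prod_congr rfl fun k _ => ?_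
    have : A (Equiv.swap i j k) = A k := by
      by_cases hi : k = i
      · subst hi; simp [h]
      · by_cases hj : k = j
        · subst hj; simp [h]
        · rw [Equiv.swap_apply_of_ne_of_ne hi hj]
    rw [this]; simp

theorem mul_nu {S : Type*} [CommSemiring S] {a b c d : S} (h : a + a = b + b)
    (h' : c + c = d + d) : a * c + a * c = b * d + b * d := by
  rw [← add_mul, h, add_mul, ← mul_add, h', mul_add]

theorem sum_nu {S ι : Type*} [CommSemiring S] (s : Finset ι) (f g : ι → S)
    (h : ∀ i, f i + f i = g i + g i) :
    ∑ i ∈ s, f i + ∑ i ∈ s, f i = ∑ i ∈ s, g i + ∑ i ∈ s, g i := by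
  simp only [← Finset.sum_add_distrib, h]

theorem prod_nu {S ι : Type*} [CommSemiring S] (s : Finset ι) (f g : ι → S)
    (h : ∀ i, f i + f i = g i + g i) :
    ∏ i ∈ s, f i + ∏ i ∈ s, f i = ∏ i ∈ s, g i + ∏ i ∈ s, g i := by
  classical
  induction s using Finset.induction_on with
  | empty => simp
  | insert a s ha ih =>
    rw [Finset.prod_insert ha, Finset.prod_insert ha]
    exact mul_nu (h a) ih

theorem per_nu {S : Type*} [CommSemiring S] {n : ℕ} (A B : Matrix (Fin n) (Fin n) S)
    (h : ∀ i j, A i j + A i j = B i j + B i j) :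
    ST.per A + ST.per A = ST.per B + ST.per B := by
  rw [per_eq, per_eq]
  exact sum_nu _ _ _ fun σ => prod_nu _ _ _ fun i => h i (σ i)

theorem entry {S : Type*} [CommSemiring S] {n : ℕ}
    (A : Matrix (Fin (n + 1)) (Fin (n + 1)) S) (u : S) (i j : Fin (n + 1)) :
    (A * (u • ST.adj A)) i j = u * ST.per (A.updateRow j (A i)) := by
  rw [← laplace, Matrix.mul_smul, Matrix.smul_apply, Matrix.mul_apply, smul_eq_mul]

theorem main {S : Type*} [CommSemiring S] (idem : ∀ a : S, (a + a) + (a + a) = a + a) {n : ℕ}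
    (A B : Matrix (Fin (n + 1)) (Fin (n + 1)) S)
    (uA uB : S) (huA : ST.per A * uA = 1) (huB : ST.per B * uB = 1)
    (hnu : ∀ i j, A i j + A i j = B i j + B i j) :
    A * (uA • ST.adj A) = B * (uB • ST.adj B) := by
  ext i j
  rw [entry, entry]
  by_cases hij : i = j
  · subst hij
    rw [Matrix.updateRow_eq_self, Matrix.updateRow_eq_self, mul_comm, huA, mul_comm, huB]
  · have hu : uA + uA = uB + uB := by
      have h := congrArg (fun x => x * (uA * uB)) (per_nu A B hnu)
      have h1 : (ST.per A + ST.per A) * (uA * uB) = uB + uB := by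
        calc _ = (ST.per A * uA) * uB + (ST.per A * uA) * uB := by ring
          _ = _ := by rw [huA, one_mul]
      have h2 : (ST.per B + ST.per B) * (uA * uB) = uA + uA := by
        calc _ = (ST.per B * uB) * uA + (ST.per B * uB) * uA := by ring
          _ = _ := by rw [huB, one_mul]
      rw [← h1, ← h2]; exact h.symm
    have hp : ∀ C : Matrix (Fin (n + 1)) (Fin (n + 1)) S,
        ∃ x, ST.per (C.updateRow j (C i)) = x + x := fun C =>
      per_double _ i j hij (by rw [Matrix.updateRow_self, Matrix.updateRow_ne hij])
    have hd : ∀ C : Matrix (Fin (n + 1)) (Fin (n + 1)) S, ∀ u : S,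
        u * ST.per (C.updateRow j (C i)) =
          u * ST.per (C.updateRow j (C i)) + u * ST.per (C.updateRow j (C i)) := by
      intro C u
      obtain ⟨x, hx⟩ := hp C
      rw [hx, ← mul_add, idem]
    rw [hd A, hd B]
    refine mul_nu hu (per_nu _ _ fun a b => ?_)
    by_cases ha : a = j
    · subst ha; simpa using hnu i b
    · simpa [Matrix.updateRow_ne ha] using hnu a b

end STAux

/-- If quasi-invertible matrices `A ≅_ν B`, then `I_A = I_B`. -/
theorem quasi_identity_nu_matched {R : Type*} [SupertropicalSemifield R] {n : ℕ}
    (A B : Matrix (Fin (n + 1)) (Fin (n + 1)) R)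
    (hA : ST.tangible (ST.per A)) (hB : ST.tangible (ST.per B))
    (uA uB : R) (huA : ST.per A * uA = 1) (huB : ST.per B * uB = 1)
    (hnu : ∀ i j, ST.nuEq (A i j) (B i j)) :
    A * (uA • ST.adj A) = B * (uB • ST.adj B) := by
  letI inst : CommSemiring R :=
    { (inferInstance : Semiring R) with mul_comm := SupertropicalDomain.mul_comm }
  exact @STAux.main R inst SupertropicalSemiring.nu_idem n A B uA uB huA huB hnu
end

section
/- For any quasi-invertible matrix A over a supertropical semifield, A^∇∇ := (A^∇)^∇ satisfies A^∇ A^∇∇ A^∇ ≅_ν A^∇ (each entry of the triple product has the same ν-value as the corresponding entry of A^∇). -/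
open Finset in
theorem two_match {N : ℕ} (a b : Fin N → Fin N) (k : Fin N)
    (h : ∀ c, (∑ r, if a r = c then (1:ℕ) else 0) + (∑ r, if b r = c then (1:ℕ) else 0) = 2) :
    ∃ ρ₁ ρ₂ : Equiv.Perm (Fin N), ρ₁ k = b k ∧
      ∀ r, (ρ₁ r = a r ∧ ρ₂ r = b r) ∨ (ρ₁ r = b r ∧ ρ₂ r = a r) := by
  let M : Matrix (Fin N) (Fin N) ℝ := fun r c =>
    ((if a r = c then (1:ℝ) else 0) + (if b r = c then (1:ℝ) else 0)) / 2
  have hM : M ∈ doublyStochastic ℝ (Fin N) := by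
    rw [mem_doublyStochastic_iff_sum]
    refine ⟨fun r c => ?_, fun r => ?_, fun c => ?_⟩
    · simp only [M]; positivity
    · simp only [M]
      rw [← Finset.sum_div, Finset.sum_add_distrib]
      simp
    · simp only [M]
      rw [← Finset.sum_div, Finset.sum_add_distrib]
      have := h c
      have h2 : ((∑ r, if a r = c then (1:ℝ) else 0) + (∑ r, if b r = c then (1:ℝ) else 0)) = 2 := by
        exact_mod_cast this
      rw [h2]; norm_num
  obtain ⟨w, hw0, hw1, hw⟩ := exists_eq_sum_perm_of_mem_doublyStochastic hM
  have hent : ∀ r c, M r c = ∑ σ : Equiv.Perm (Fin N), w σ * (if σ r = c then 1 else 0) := by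
    intro r c
    rw [← hw, Matrix.sum_apply]
    refine Finset.sum_congr rfl fun σ _ => ?_
    simp [Equiv.Perm.permMatrix, PEquiv.toMatrix_apply, eq_comm]
  have hpos : 0 < M k (b k) := by
    simp only [M]; simp; positivity
  obtain ⟨ρ₁, hρ⟩ : ∃ ρ : Equiv.Perm (Fin N), 0 < w ρ * (if ρ k = b k then 1 else 0) := by
    by_contra hc
    push Not at hc
    rw [hent] at hpos
    exact absurd hpos (not_lt.2 (Finset.sum_nonpos fun σ _ => hc σ))
  have hk : ρ₁ k = b k := by
    by_contra hc
    simp [hc] at hρ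
  have hwp : 0 < w ρ₁ := by simpa [hk] using hρ
  have hr : ∀ r, ρ₁ r = a r ∨ ρ₁ r = b r := by
    intro r
    by_contra hc
    push Not at hc
    have h1 : M r (ρ₁ r) = 0 := by
      simp only [M]; simp [hc.1.symm, hc.2.symm]
    rw [hent] at h1
    have h2 := Finset.single_le_sum (f := fun σ : Equiv.Perm (Fin N) => w σ * (if σ r = ρ₁ r then 1 else 0))
      (fun σ _ => mul_nonneg (hw0 σ) (by positivity)) (mem_univ ρ₁)
    simp only [h1] at h2
    simp at h2
    linarith
  let f : Fin N → Fin N := fun r => if ρ₁ r = b r then a r else b r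
  have hf : ∀ r, (ρ₁ r = a r ∧ f r = b r) ∨ (ρ₁ r = b r ∧ f r = a r) := by
    intro r
    by_cases hb : ρ₁ r = b r
    · right; simp [f, hb]
    · left; simpa [f, hb] using (hr r).resolve_right hb
  have hcount : ∀ c, (∑ r, if f r = c then (1:ℕ) else 0) = 1 := by
    intro c
    have h1 : (∑ r, if ρ₁ r = c then (1:ℕ) else 0) = 1 := by
      rw [Equiv.sum_comp ρ₁ (fun x => if x = c then (1:ℕ) else 0)]; simp
    have h2 : (∑ r, if ρ₁ r = c then (1:ℕ) else 0) + (∑ r, if f r = c then (1:ℕ) else 0) = 2 := by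
      rw [← h c, ← Finset.sum_add_distrib, ← Finset.sum_add_distrib]
      refine Finset.sum_congr rfl fun r _ => ?_
      rcases hf r with ⟨h1, h2⟩ | ⟨h1, h2⟩
      · rw [h1, h2]
      · rw [h1, h2, add_comm]
    omega
  have hsurj : Function.Surjective f := by
    intro c
    by_contra hc
    push Not at hc
    have := hcount c
    simp [hc] at this
  exact ⟨ρ₁, Equiv.ofBijective f (Finite.surjective_iff_bijective.1 hsurj), hk, hf⟩

open Finset in
theorem switch_match {V : Type*} [CommMonoid V] {N : ℕ} (σ τ : Equiv.Perm (Fin N)) (j k : Fin N) :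
    ∃ ρ₁ ρ₂ : Equiv.Perm (Fin N), ρ₁ k = σ j ∧ ∀ g : Fin N → Fin N → V,
      (∏ m ∈ univ.erase j, g m (σ m)) * g j (τ k) * (∏ m ∈ univ.erase k, g m (τ m)) =
      (∏ m, g m (ρ₂ m)) * ∏ m ∈ univ.erase k, g m (ρ₁ m) := by
  have key : ∀ (σ : Equiv.Perm (Fin N)) (j x c : Fin N),
      (∑ r, if Function.update σ j x r = c then (1:ℕ) else 0) + (if σ j = c then 1 else 0)
        = 1 + if x = c then 1 else 0 := by
    intro σ j x c
    have h1 : (∑ r, if σ r = c then (1:ℕ) else 0) = 1 := by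
      rw [Equiv.sum_comp σ (fun x => if x = c then (1:ℕ) else 0)]; simp
    rw [← add_sum_erase _ _ (mem_univ j)] at h1 ⊢
    have h2 : (∑ r ∈ univ.erase j, if Function.update σ j x r = c then (1:ℕ) else 0) =
        ∑ r ∈ univ.erase j, if σ r = c then (1:ℕ) else 0 := by
      refine Finset.sum_congr rfl fun r hr => ?_
      rw [Function.update_of_ne (ne_of_mem_erase hr)]
    rw [h2, Function.update_self]
    omega
  obtain ⟨ρ₁, ρ₂, hk, hr⟩ := two_match (Function.update σ j (τ k)) (Function.update τ k (σ j)) k (by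
    intro c
    have h1 := key σ j (τ k) c
    have h2 := key τ k (σ j) c
    omega)
  rw [Function.update_self] at hk
  refine ⟨ρ₁, ρ₂, hk, fun g => ?_⟩
  have e1 : (∏ m ∈ univ.erase j, g m (σ m)) * g j (τ k) =
      ∏ m, g m (Function.update σ j (τ k) m) := by
    rw [← mul_prod_erase _ _ (mem_univ j), Function.update_self, mul_comm]
    congr 1
    refine Finset.prod_congr rfl fun r hr => ?_
    rw [Function.update_of_ne (ne_of_mem_erase hr)]
  have e2 : (∏ m ∈ univ.erase k, g m (τ m)) =
      ∏ m ∈ univ.erase k, g m (Function.update τ k (σ j) m) := by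
    refine Finset.prod_congr rfl fun r hr => ?_
    rw [Function.update_of_ne (ne_of_mem_erase hr)]
  have e3 : ρ₂ k = Function.update σ j (τ k) k := by
    rcases hr k with ⟨h1, h2⟩ | ⟨h1, h2⟩
    · rw [h2, ← h1, hk, Function.update_self]
    · exact h2
  rw [e1, e2, ← mul_prod_erase _ _ (mem_univ k), ← mul_prod_erase _ _ (mem_univ k), e3,
    mul_assoc, mul_assoc, ← prod_mul_distrib, ← prod_mul_distrib]
  congr 1
  refine Finset.prod_congr rfl fun r _ => ?_
  rcases hr r with ⟨h1, h2⟩ | ⟨h1, h2⟩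
  · rw [h1, h2, mul_comm]
  · rw [h1, h2]

open Finset in
/-- elimination lemma -/
theorem elim_le {V : Type*} [CommMonoid V] [Preorder V] [IsOrderedMonoid V] {N : ℕ}
    (C : Fin N → Fin N → V) (htr : ∀ i j k, C i j * C j k ≤ C i k) (h1 : ∀ i, 1 ≤ C i i)
    (j : Fin N) (s : ℕ) : ∀ (σ : Equiv.Perm (Fin N)), σ.support.card = s →
    (∀ i, C i i ≤ 1) → ∏ m ∈ univ.erase j, C m (σ m) ≤ C (σ j) j := by
  induction s using Nat.strong_induction_on with
  | _ s ih =>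
  intro σ hs h1'
  by_cases hex : ∃ k, k ≠ j ∧ σ k ≠ k
  · obtain ⟨k, hkj, hk⟩ := hex
    set σ' := Equiv.swap k (σ k) * σ with hσ'
    have hlt := Equiv.Perm.card_support_swap_mul hk
    have ih' := ih _ (by rw [← hs]; exact hlt) σ' rfl h1'
    have hσk : σ' k = k := by simp [hσ']
    have hmk : σ' (σ⁻¹ k) = σ k := by simp [hσ']
    have hoth : ∀ m, m ≠ k → m ≠ σ⁻¹ k → σ' m = σ m := by
      intro m hm hm'
      simp only [hσ', Equiv.Perm.mul_apply]
      apply Equiv.swap_apply_of_ne_of_ne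
      · intro h; apply hm'; rw [← h]; simp
      · intro h; exact hm (σ.injective h)
    have hkm : k ∈ univ.erase j := by simp [hkj]
    by_cases hm : σ⁻¹ k = j
    · have hjk : σ j = k := by rw [← hm]; simp
      rw [hm] at hmk hoth
      rw [hmk] at ih'
      rw [hjk, ← mul_prod_erase _ _ hkm]
      refine le_trans (mul_le_mul_right ?_ _) (htr k (σ k) j)
      refine le_trans ?_ ih'
      rw [← mul_prod_erase _ _ hkm, hσk]
      refine le_trans (le_of_eq ?_) (le_mul_of_one_le_left' (h1 k))
      refine Finset.prod_congr rfl fun m hm => ?_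
      simp only [mem_erase] at hm
      rw [hoth m hm.1 hm.2.1]
    · have hmk' : σ⁻¹ k ≠ k := by
        intro h; apply hk
        conv_lhs => rw [← h]
        simp
      have hmm : σ⁻¹ k ∈ (univ.erase j).erase k := by simp only [mem_erase]; exact ⟨hmk', hm, mem_univ _⟩
      rw [hoth j hkj.symm (Ne.symm hm)] at ih'
      refine le_trans ?_ ih'
      rw [← mul_prod_erase _ _ hkm, ← mul_prod_erase _ _ hmm,
        ← mul_prod_erase _ (fun m => C m (σ' m)) hkm, ← mul_prod_erase _ _ hmm, hσk, hmk,
        ← mul_assoc, ← mul_assoc]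
      refine mul_le_mul' ?_ (le_of_eq ?_)
      · refine le_trans ?_ (le_mul_of_one_le_left' (h1 k))
        rw [mul_comm]
        have := htr (σ⁻¹ k) k (σ k)
        simpa using this
      · refine Finset.prod_congr rfl fun m hm => ?_
        simp only [mem_erase] at hm
        rw [hoth m hm.2.1 hm.1]
  · push Not at hex
    have hj : σ = 1 := by
      have h2 : ∀ k, k ≠ j → σ k = k := hex
      ext1 x
      by_cases hx : x = j
      · by_contra hne
        have h3 : σ x ≠ j := by intro h; apply hne; rw [h, hx]; rfl
        have := σ.injective (h2 _ h3)
        exact hne this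
      · exact h2 x hx
    subst hj
    refine le_trans ?_ (h1 j)
    exact Finset.prod_le_one' fun m _ => h1' m

/-- Selective ordered additive structure. -/
class TropLike (V : Type*) [CommSemiring V] [Preorder V] : Prop where
  add_le : ∀ {a b c : V}, a ≤ c → b ≤ c → a + b ≤ c
  le_add : ∀ (a b : V), a ≤ a + b
  sel : ∀ (a b : V), a + b ≤ a ∨ a + b ≤ b

section Trop
open Finset
variable {V : Type*} [CommSemiring V] [Preorder V] [TropLike V]

theorem trop_zero_le (a : V) : 0 ≤ a := by
  have := TropLike.le_add 0 a
  rwa [zero_add] at this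

theorem trop_sum_le {ι : Type*} (s : Finset ι) (f : ι → V) (c : V) (h : ∀ i ∈ s, f i ≤ c) :
    ∑ i ∈ s, f i ≤ c := by
  classical
  induction s using Finset.induction_on with
  | empty => rw [sum_empty]; exact trop_zero_le c
  | insert a s ha ih =>
    rw [sum_insert ha]
    exact TropLike.add_le (h a (mem_insert_self a s)) (ih fun i hi => h i (mem_insert_of_mem hi))

theorem trop_le_sum {ι : Type*} (s : Finset ι) (f : ι → V) (i : ι) (h : i ∈ s) :
    f i ≤ ∑ i ∈ s, f i := by
  classical
  rw [← add_sum_erase _ _ h]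
  exact TropLike.le_add _ _

theorem trop_exists_sum_le {ι : Type*} (s : Finset ι) (hs : s.Nonempty) (f : ι → V) :
    ∃ i ∈ s, ∑ i ∈ s, f i ≤ f i := by
  classical
  induction hs using Finset.Nonempty.cons_induction with
  | singleton a => exact ⟨a, by simp, by simp⟩
  | cons a s ha hs ih =>
    obtain ⟨i, hi, hle⟩ := ih
    rw [sum_cons]
    rcases TropLike.sel (f a) (∑ i ∈ s, f i) with h | h
    · exact ⟨a, by simp, h⟩
    · exact ⟨i, by simp [hi], h.trans hle⟩

theorem per_eq {V : Type*} [CommSemiring V] {N : ℕ} (A : Matrix (Fin N) (Fin N) V) :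
    ST.per A = ∑ σ : Equiv.Perm (Fin N), ∏ m, A m (σ m) := by
  simp [ST.per, List.prod_ofFn]

theorem le_per {N : ℕ} (A : Matrix (Fin N) (Fin N) V) (σ : Equiv.Perm (Fin N)) :
    ∏ m, A m (σ m) ≤ ST.per A := by
  rw [per_eq]
  exact trop_le_sum _ (fun σ : Equiv.Perm (Fin N) => ∏ m, A m (σ m)) σ (mem_univ _)

theorem exists_per_le {N : ℕ} (A : Matrix (Fin N) (Fin N) V) :
    ∃ σ : Equiv.Perm (Fin N), ST.per A ≤ ∏ m, A m (σ m) := by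
  rw [per_eq]
  obtain ⟨σ, _, h⟩ := trop_exists_sum_le univ univ_nonempty
    (fun σ : Equiv.Perm (Fin N) => ∏ m, A m (σ m))
  exact ⟨σ, h⟩

theorem prod_erase_succAbove {V : Type*} [CommMonoid V] {n : ℕ} (j : Fin (n + 1))
    (f : Fin (n + 1) → V) : ∏ m ∈ univ.erase j, f m = ∏ m, f (j.succAbove m) := by
  have : (univ.erase j) = univ.image j.succAbove := by
    rw [Fin.image_succAbove_univ]; ext; simp
  rw [this, prod_image (fun a _ b _ h => Fin.succAbove_right_injective h)]

theorem prod_erase_perm {V : Type*} [CommMonoid V] {N : ℕ} (e : Equiv.Perm (Fin N)) (k : Fin N)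
    (f : Fin N → V) : ∏ m ∈ univ.erase k, f (e m) = ∏ m ∈ univ.erase (e k), f m := by
  refine Finset.prod_equiv e ?_ ?_
  · intro i; simp
  · intro i _; rfl

theorem le_adj {n : ℕ} (A : Matrix (Fin (n + 1)) (Fin (n + 1)) V)
    (σ : Equiv.Perm (Fin (n + 1))) (j : Fin (n + 1)) :
    ∏ m ∈ univ.erase j, A m (σ m) ≤ ST.adj A (σ j) j := by
  have hex : ∀ m, ∃ x, (σ j).succAbove x = σ (j.succAbove m) := fun m =>
    Fin.exists_succAbove_eq (fun h => Fin.succAbove_ne j m (σ.injective h))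
  choose f hf using hex
  have hinj : Function.Injective f := by
    intro a b hab
    have : σ (j.succAbove a) = σ (j.succAbove b) := by rw [← hf, ← hf, hab]
    exact Fin.succAbove_right_injective (σ.injective this)
  have := le_per (A.submatrix j.succAbove (σ j).succAbove)
    (Equiv.ofBijective f (Finite.injective_iff_bijective.1 hinj))
  rw [prod_erase_succAbove]
  simpa [hf, ST.adj] using this

theorem exists_adj_le {n : ℕ} (A : Matrix (Fin (n + 1)) (Fin (n + 1)) V) (i j : Fin (n + 1)) :
    ∃ σ : Equiv.Perm (Fin (n + 1)), σ j = i ∧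
      ST.adj A i j ≤ ∏ m ∈ univ.erase j, A m (σ m) := by
  obtain ⟨τ, h⟩ := exists_per_le (A.submatrix j.succAbove i.succAbove)
  refine ⟨((finSuccEquiv' j).trans (Equiv.optionCongr τ)).trans (finSuccEquiv' i).symm, by simp, ?_⟩
  rw [prod_erase_succAbove]
  simpa [ST.adj] using h

variable [IsOrderedMonoid V]

theorem adj_tri {n : ℕ} (A : Matrix (Fin (n + 1)) (Fin (n + 1)) V) (i j l k : Fin (n + 1)) :
    ST.adj A i j * A j l * ST.adj A l k ≤ ST.per A * ST.adj A i k := by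
  obtain ⟨σ, rfl, hσ⟩ := exists_adj_le A i j
  obtain ⟨τ, rfl, hτ⟩ := exists_adj_le A l k
  obtain ⟨ρ₁, ρ₂, hk, h⟩ := switch_match (V := V) σ τ j k
  refine (mul_le_mul' (mul_le_mul' hσ le_rfl) hτ).trans ?_
  rw [h A, ← hk]
  exact mul_le_mul' (le_per A ρ₂) (le_adj A ρ₁ k)

theorem adj_diag {n : ℕ} (A : Matrix (Fin (n + 1)) (Fin (n + 1)) V) (i j : Fin (n + 1)) :
    ST.adj A i j * A j i ≤ ST.per A := by
  obtain ⟨σ, rfl, hσ⟩ := exists_adj_le A i j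
  refine (mul_le_mul' hσ le_rfl).trans ?_
  rw [mul_comm, mul_prod_erase univ (fun m => A m (σ m)) (mem_univ j)]
  exact le_per A σ

theorem core_le {n : ℕ} (A B : Matrix (Fin (n + 1)) (Fin (n + 1)) V) (u : V)
    (hu : ST.per A * u = 1) (hB : ∀ i j, B i j = u * ST.adj A i j) (i j k l : Fin (n + 1)) :
    B i j * ST.adj B j k * B k l ≤ ST.per B * B i l := by
  obtain ⟨π, hπ⟩ := exists_per_le A
  have triB : ∀ i j l k, B i j * A j l * B l k ≤ B i k := by
    intro i j l k
    rw [hB, hB, hB]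
    calc u * ST.adj A i j * A j l * (u * ST.adj A l k)
        = u * u * (ST.adj A i j * A j l * ST.adj A l k) := by ring
      _ ≤ u * u * (ST.per A * ST.adj A i k) := mul_le_mul' le_rfl (adj_tri A i j l k)
      _ = (ST.per A * u) * (u * ST.adj A i k) := by ring
      _ = u * ST.adj A i k := by rw [hu, one_mul]
  have dle : ∀ m, B (π m) m * A m (π m) ≤ 1 := by
    intro m
    rw [hB]
    calc u * ST.adj A (π m) m * A m (π m) = u * (ST.adj A (π m) m * A m (π m)) := by ring
      _ ≤ u * ST.per A := mul_le_mul' le_rfl (adj_diag A _ _)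
      _ = 1 := by rw [mul_comm, hu]
  have dge : ∀ m, 1 ≤ B (π m) m * A m (π m) := by
    intro m
    rw [hB]
    calc (1 : V) = u * ST.per A := by rw [mul_comm, hu]
      _ ≤ u * ∏ m, A m (π m) := mul_le_mul' le_rfl hπ
      _ = u * (A m (π m) * ∏ m ∈ univ.erase m, A m (π m)) := by
        rw [mul_prod_erase univ (fun m => A m (π m)) (mem_univ m)]
      _ ≤ u * (A m (π m) * ST.adj A (π m) m) :=
        mul_le_mul' le_rfl (mul_le_mul' le_rfl (le_adj A π m))
      _ = u * ST.adj A (π m) m * A m (π m) := by ring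
  have hone : 1 ≤ ST.per B * ∏ m, A m (π m) := by
    have h1 : ∏ m, B (π m) m ≤ ST.per B := by
      have := le_per B π⁻¹
      rw [← Equiv.prod_comp π] at this
      simpa using this
    refine le_trans ?_ (mul_le_mul' h1 le_rfl)
    rw [← prod_mul_distrib]
    exact Finset.one_le_prod' fun m _ => dge m
  obtain ⟨σ, rfl, hσ⟩ := exists_adj_le B j k
  obtain ⟨k', rfl⟩ := π.surjective k
  let C : Fin (n + 1) → Fin (n + 1) → V := fun a b => B (π a) b * A b (π b)
  have hC := elim_le C (by
      intro a b c
      simp only [C]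
      rw [← mul_assoc]
      exact mul_le_mul' (triB _ _ _ _) le_rfl) dge k' _ (σ * π) rfl dle
  have hT : (∏ m ∈ univ.erase (π k'), B m (σ m)) * ∏ m ∈ univ.erase (σ (π k')), A m (π m)
      ≤ C (σ (π k')) k' := by
    refine le_trans (le_of_eq ?_) hC
    simp only [C, Equiv.Perm.mul_apply]
    rw [prod_mul_distrib, prod_erase_perm π k' (fun m => B m (σ m)),
      prod_erase_perm π k' (fun m => A (σ m) (π (σ m))),
      prod_erase_perm σ (π k') (fun m => A m (π m))]
  have hX : B i (σ (π k')) * ST.adj B (σ (π k')) (π k') * B (π k') l * ∏ m, A m (π m)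
      ≤ B i l := by
    set j := σ (π k') with hj
    rw [← mul_prod_erase univ (fun m => A m (π m)) (mem_univ j)]
    calc B i j * ST.adj B j (π k') * B (π k') l * (A j (π j) * ∏ m ∈ univ.erase j, A m (π m))
        = B i j * A j (π j) * (ST.adj B j (π k') * (∏ m ∈ univ.erase j, A m (π m)))
          * B (π k') l := by ring
      _ ≤ B i j * A j (π j) * C j k' * B (π k') l :=
        mul_le_mul' (mul_le_mul' le_rfl ((mul_le_mul' hσ le_rfl).trans hT)) le_rfl
      _ = B i j * A j (π j) * (B (π j) k' * A k' (π k') * B (π k') l) := by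
        simp only [C]; ring
      _ ≤ B i j * A j (π j) * B (π j) l := mul_le_mul' le_rfl (triB _ _ _ _)
      _ ≤ B i l := triB _ _ _ _
  calc _ ≤ B i (σ (π k')) * ST.adj B (σ (π k')) (π k') * B (π k') l
        * (ST.per B * ∏ m, A m (π m)) := le_mul_of_one_le_right' hone
    _ = ST.per B * (B i (σ (π k')) * ST.adj B (σ (π k')) (π k') * B (π k') l
        * ∏ m, A m (π m)) := by ring
    _ ≤ _ := mul_le_mul' le_rfl hX

theorem triple_le {n : ℕ} (A B : Matrix (Fin (n + 1)) (Fin (n + 1)) V) (u u' : V)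
    (hu : ST.per A * u = 1) (hB : ∀ i j, B i j = u * ST.adj A i j) (hu' : ST.per B * u' = 1)
    (i l : Fin (n + 1)) :
    ∑ k, (∑ j, B i j * (u' * ST.adj B j k)) * B k l ≤ B i l := by
  refine trop_sum_le _ _ _ fun k _ => ?_
  rw [sum_mul]
  refine trop_sum_le _ _ _ fun j _ => ?_
  calc B i j * (u' * ST.adj B j k) * B k l = u' * (B i j * ST.adj B j k * B k l) := by ring
    _ ≤ u' * (ST.per B * B i l) := mul_le_mul' le_rfl (core_le A B u hu hB i j k l)
    _ = (ST.per B * u') * B i l := by ring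
    _ = B i l := by rw [hu', one_mul]

theorem le_triple {n : ℕ} (B : Matrix (Fin (n + 1)) (Fin (n + 1)) V) (u' : V)
    (hu' : ST.per B * u' = 1) (i l : Fin (n + 1)) :
    B i l ≤ ∑ k, (∑ j, B i j * (u' * ST.adj B j k)) * B k l := by
  refine le_trans ?_ (trop_le_sum _ (fun k => (∑ j, B i j * (u' * ST.adj B j k)) * B k l) i
    (mem_univ _))
  obtain ⟨σ, hσ⟩ := exists_per_le B
  have h1 : (1 : V) ≤ ∑ j, B i j * (u' * ST.adj B j i) := by
    refine le_trans ?_ (trop_le_sum _ (fun j => B i j * (u' * ST.adj B j i)) (σ i) (mem_univ _))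
    calc (1 : V) = ST.per B * u' := hu'.symm
      _ ≤ (∏ m, B m (σ m)) * u' := mul_le_mul' hσ le_rfl
      _ = B i (σ i) * (u' * ∏ m ∈ univ.erase i, B m (σ m)) := by
        rw [← mul_prod_erase univ (fun m => B m (σ m)) (mem_univ i)]; ring
      _ ≤ _ := mul_le_mul' le_rfl (mul_le_mul' le_rfl (le_adj B σ i))
  exact le_mul_of_one_le_left' h1

end Trop

/-- commutative semiring structure -/
@[reducible] def stComm (R : Type*) [h : SupertropicalSemifield R] : CommSemiring R :=
  { h.toSemiring with mul_comm := SupertropicalDomain.mul_comm }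

/-- the preorder by ν-values -/
@[reducible] def stPre (R : Type*) [SupertropicalSemifield R] : Preorder R where
  le a b := ST.nuLe a b
  le_refl a := SupertropicalSemiring.nu_idem a
  le_trans a b c hab hbc := by
    unfold ST.nuLe at *
    rw [← hbc, ← add_assoc, hab]

theorem st_ord (R : Type*) [SupertropicalSemifield R] :
    @IsOrderedMonoid R (stComm R).toCommMonoid (stPre R) := by
  letI := stComm R
  letI := stPre R
  refine { mul_le_mul_left := ?_ }
  intro a b hab c
  change (a * c + a * c) + (b * c + b * c) = b * c + b * c
  have h : (a + a) + (b + b) = b + b := hab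
  rw [← add_mul, ← add_mul, ← add_mul, h]

theorem st_trop (R : Type*) [SupertropicalSemifield R] :
    @TropLike R (stComm R) (stPre R) := by
  letI := stComm R
  letI := stPre R
  refine { add_le := ?_, le_add := ?_, sel := ?_ }
  · intro a b c (ha : (a + a) + (c + c) = c + c) (hb : (b + b) + (c + c) = c + c)
    change (a + b + (a + b)) + (c + c) = c + c
    rw [add_add_add_comm a b a b, add_assoc, hb, ha]
  · intro a b
    change (a + a) + (a + b + (a + b)) = (a + b + (a + b))
    rw [add_add_add_comm a b a b, ← add_assoc, SupertropicalSemiring.nu_idem a]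
  · intro a b
    by_cases h : a + a = b + b
    · left
      rw [SupertropicalSemiring.add_eq_nu h]
      change (a + a + (a + a)) + (a + a) = a + a
      rw [SupertropicalSemiring.nu_idem a, SupertropicalSemiring.nu_idem a]
    · rcases SupertropicalSemiring.add_cases h with h | h
      · left; rw [h]
      · right; rw [h]

/-- For quasi-invertible `A`, `A^∇ A^∇∇ A^∇ ≅_ν A^∇`. -/
theorem nabla_triple_nu_eq {R : Type*} [SupertropicalSemifield R] {n : ℕ}
    (A : Matrix (Fin (n + 1)) (Fin (n + 1)) R)
    (hA : ST.tangible (ST.per A)) (u : R) (hu : ST.per A * u = 1) :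
    ∀ u' : R, ST.per (u • ST.adj A) * u' = 1 →
      ∀ i j, ST.nuEq
        (((u • ST.adj A) * (u' • ST.adj (u • ST.adj A)) * (u • ST.adj A)) i j)
        ((u • ST.adj A) i j) := by
  intro u' hu' i j
  letI := stComm R
  letI := stPre R
  haveI := st_ord R
  haveI := st_trop R
  have h1 := triple_le A (u • ST.adj A) u u' hu (fun _ _ => rfl) hu' i j
  have h2 := le_triple (u • ST.adj A) u' hu' i j
  have e : ((u • ST.adj A) * (u' • ST.adj (u • ST.adj A)) * (u • ST.adj A)) i j =
      ∑ k, (∑ m, (u • ST.adj A) i m * (u' * ST.adj (u • ST.adj A) m k)) * (u • ST.adj A) k j := by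
    rw [Matrix.mul_apply]
    refine Finset.sum_congr rfl fun k _ => ?_
    rw [Matrix.mul_apply]
    rfl
  rw [ST.nuEq, e]
  have h1' : ST.nuLe _ _ := h1
  have h2' : ST.nuLe _ _ := h2
  unfold ST.nuLe at h1' h2'
  exact h2'.symm.trans ((add_comm _ _).trans h1')
end

section
/- Let A be a quasi-invertible matrix over a supertropical semifield with tangible retract ν̂, and set A^ν̂∇ = |A|^{-1} ν̂(adj A). Then (A^ν̂∇)^ν̂∇ · A^ν̂∇ = I_A; equivalently, the left quasi-identity of A^ν̂∇ equals the right quasi-identity I_A = A A^∇ of A. -/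
namespace STP
open ST SupertropicalSemiring

@[reducible] instance instCS (R : Type*) [h : SupertropicalSemifield R] : CommSemiring R :=
  { h.toSemiring with mul_comm := SupertropicalDomain.mul_comm }

section basic
variable {R : Type*} [SupertropicalSemifield R]

theorem le_refl (a : R) : nuLe a a := nu_idem a

theorem le_trans {a b c : R} (h1 : nuLe a b) (h2 : nuLe b c) : nuLe a c := by
  unfold nuLe at *
  rw [← h2, ← add_assoc, h1]

instance : Trans (nuLe : R → R → Prop) nuLe nuLe := ⟨le_trans⟩

theorem le_of_nuEq {a b : R} (h : a + a = b + b) : nuLe a b := by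
  unfold nuLe; rw [h]; exact nu_idem b

theorem nuEq_of_le {a b : R} (h : nuLe a b) (h' : nuLe b a) : a + a = b + b := by
  unfold nuLe at *
  rw [← h, add_comm (a + a), h']

theorem le_total (a b : R) : nuLe a b ∨ nuLe b a := by
  by_cases h : a + a = b + b
  · exact Or.inl (le_of_nuEq h)
  · unfold nuLe
    rcases add_cases h with h1 | h1
    · right
      calc (b + b) + (a + a) = (a + b) + (a + b) := by abel
        _ = _ := by rw [h1]
    · left
      calc (a + a) + (b + b) = (a + b) + (a + b) := by abel
        _ = _ := by rw [h1]

theorem zero_le (a : R) : nuLe 0 a := by unfold nuLe; simp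

theorem add_le {a b c : R} (h : nuLe a c) (h' : nuLe b c) : nuLe (a + b) c := by
  unfold nuLe at *
  calc (a + b) + (a + b) + (c + c) = (a + a) + ((b + b) + (c + c)) := by abel
    _ = _ := by rw [h', h]

theorem le_add_left (a b : R) : nuLe a (a + b) := by
  unfold nuLe
  calc (a + a) + ((a + b) + (a + b)) = ((a + a) + (a + a)) + (b + b) := by abel
    _ = (a + a) + (b + b) := by rw [nu_idem]
    _ = _ := by abel

theorem mul_le_r {a b : R} (h : nuLe a b) (c : R) : nuLe (a * c) (b * c) := by
  unfold nuLe at *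
  rw [← add_mul, ← add_mul, ← add_mul, h]

theorem mul_le {a b c d : R} (h : nuLe a b) (h' : nuLe c d) : nuLe (a * c) (b * d) := by
  refine le_trans (mul_le_r h c) ?_
  rw [mul_comm b c, mul_comm b d]
  exact mul_le_r h' b

theorem mul_le_l {a b : R} (h : nuLe a b) (c : R) : nuLe (c * a) (c * b) :=
  mul_le (le_refl c) h

theorem sum_le {ι : Type*} (s : Finset ι) (x : ι → R) (b : R) (h : ∀ i ∈ s, nuLe (x i) b) :
    nuLe (∑ i ∈ s, x i) b := by
  classical
  induction s using Finset.induction_on with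
  | empty => simpa using zero_le b
  | insert i s hi ih =>
    rw [Finset.sum_insert hi]
    exact add_le (h i (by simp)) (ih fun k hk => h k (by simp [hk]))

theorem le_sum {ι : Type*} (s : Finset ι) (x : ι → R) (i : ι) (hi : i ∈ s) :
    nuLe (x i) (∑ i ∈ s, x i) := by
  classical
  rw [← Finset.add_sum_erase s x hi]
  exact le_add_left _ _

theorem exists_max {ι : Type*} (s : Finset ι) (hs : s.Nonempty) (x : ι → R) :
    ∃ i ∈ s, ∀ k ∈ s, nuLe (x k) (x i) := by
  classical
  induction hs using Finset.Nonempty.cons_induction with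
  | singleton a => exact ⟨a, by simp, by simpa using le_refl _⟩
  | cons a s ha hs ih =>
    obtain ⟨i, hi, h⟩ := ih
    rcases le_total (x a) (x i) with h1 | h1
    · refine ⟨i, by simp [hi], fun k hk => ?_⟩
      rcases Finset.mem_cons.1 hk with rfl | hk
      · exact h1
      · exact h k hk
    · refine ⟨a, by simp, fun k hk => ?_⟩
      rcases Finset.mem_cons.1 hk with rfl | hk
      · exact le_refl _
      · exact le_trans (h k hk) h1

theorem sum_attained {ι : Type*} (s : Finset ι) (hs : s.Nonempty) (x : ι → R) :
    ∃ i ∈ s, nuLe (∑ i ∈ s, x i) (x i) := by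
  obtain ⟨i, hi, h⟩ := exists_max s hs x
  exact ⟨i, hi, sum_le s x _ h⟩

theorem prod_le {ι : Type*} (s : Finset ι) (x y : ι → R) (h : ∀ i ∈ s, nuLe (x i) (y i)) :
    nuLe (∏ i ∈ s, x i) (∏ i ∈ s, y i) := by
  classical
  induction s using Finset.induction_on with
  | empty => simpa using le_refl _
  | insert i s hi ih =>
    rw [Finset.prod_insert hi, Finset.prod_insert hi]
    exact mul_le (h i (by simp)) (ih fun k hk => h k (by simp [hk]))

theorem ghost_idem {g : R} (h : ghost g) : g + g = g := by
  by_cases h0 : g = 0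
  · simp [h0]
  · obtain ⟨t, _, rfl⟩ := SupertropicalDomain.nu_onto h h0
    exact nu_idem t

theorem ghost_eq {g g' : R} (h : ghost g) (h' : ghost g') (e : nuLe g g') (e' : nuLe g' g) :
    g = g' := by
  rw [← ghost_idem h, ← ghost_idem h']; exact nuEq_of_le e e'

theorem add_small {a r : R} (h : nuLe r a) (h' : ¬ nuLe a r) : a + r = a := by
  have hne : a + a ≠ r + r := fun e => h' (le_of_nuEq e)
  rcases add_cases hne with e | e
  · exact e
  · exfalso; apply h'
    have := le_add_left a r
    rwa [e] at this

theorem ghost_add_small {g r : R} (hg : ghost g) (h : nuLe r g) : g + r = g := by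
  by_cases h' : nuLe g r
  · have := nuEq_of_le h' h
    rw [add_eq_nu this, ghost_idem hg]
  · exact add_small h h'

theorem sum_small {ι : Type*} (s : Finset ι) (x : ι → R) (a : R)
    (h : ∀ i ∈ s, ¬ nuLe a (x i)) : a + ∑ i ∈ s, x i = a := by
  classical
  induction s using Finset.induction_on with
  | empty => simp
  | insert i s hi ih =>
    rw [Finset.sum_insert hi, ← add_assoc, add_small _ (h i (by simp)),
      ih fun k hk => h k (by simp [hk])]
    exact (le_total _ _).resolve_right (h i (by simp))

theorem ghost_sum {ι : Type*} [DecidableEq ι] (s : Finset ι) (x : ι → R) (i j : ι) (hi : i ∈ s)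
    (hj : j ∈ s) (hij : i ≠ j) (h : ∀ k ∈ s, nuLe (x k) (x i)) (h' : nuLe (x i) (x j)) :
    ghost (∑ k ∈ s, x k) := by
  have hj' : j ∈ s.erase i := by simp [hj, hij.symm]
  rw [← Finset.add_sum_erase s x hi, ← Finset.add_sum_erase _ x hj', ← add_assoc,
    add_eq_nu (nuEq_of_le h' (h j hj)), ghost_add_small (nu_ghost _)]
  · exact nu_ghost _
  · refine le_trans (sum_le _ _ (x i) fun k hk => h k ?_) (le_add_left _ _)
    simp at hk; exact hk.2.2

theorem sum_replace {ι : Type*} [DecidableEq ι] (s : Finset ι) (z w : ι → R)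
    (ht : tangible (∑ k ∈ s, z k))
    (h1 : ∀ k, z k + z k = w k + w k) (h2 : ∀ k, tangible (z k) → w k = z k) :
    ∑ k ∈ s, w k = ∑ k ∈ s, z k := by
  rcases s.eq_empty_or_nonempty with rfl | hs
  · simp
  obtain ⟨i, hi, h⟩ := exists_max s hs z
  have hn : ∀ k ∈ s.erase i, ¬ nuLe (z i) (z k) := fun k hk hle => by
    simp at hk
    exact ht (ghost_sum s z i k hi hk.2 (Ne.symm hk.1) h hle)
  have hz : ∑ k ∈ s, z k = z i := by
    rw [← Finset.add_sum_erase s z hi, sum_small _ _ _ hn]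
  rw [hz] at ht ⊢
  have hw := h2 i ht
  rw [← Finset.add_sum_erase s w hi, hw, sum_small]
  intro k hk hle
  exact hn k hk (le_trans hle (le_of_nuEq (h1 k).symm))

theorem retract_nu (f : TangibleRetract R) (a : R) : f a + f a = a + a := by
  by_cases h : ghost a
  · rw [f.nu_section a h, ghost_idem h]
  · rw [f.id_on_T0 a (Or.inr h)]

end basic

section comb
variable {ι : Type*} [Fintype ι] [DecidableEq ι]

theorem exists_split (θ : Equiv.Perm ι) (j l : ι) (hjl : j ≠ l) :
    (∃ O : Finset ι, j ∈ O ∧ l ∉ O ∧ ∀ k ∈ O, θ k ∈ O) ∨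
    (∃ O : Finset ι, l ∈ O ∧ j ∉ O ∧ ∀ k ∈ O, (θ * Equiv.swap j l) k ∈ O) := by
  classical
  by_cases h : ∃ n : ℕ, (θ ^ n) j = l
  · right
    have hn := Nat.find_spec h
    have hmin : ∀ m, m < Nat.find h → (θ ^ m) j ≠ l := fun m hm => Nat.find_min h hm
    set n := Nat.find h
    have hn0 : n ≠ 0 := by rintro e; rw [e] at hn; exact hjl (by simpa using hn)
    refine ⟨(Finset.Icc 1 n).image fun m => (θ ^ m) j, ?_, ?_, ?_⟩
    · simp only [Finset.mem_image, Finset.mem_Icc]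
      exact ⟨n, ⟨by omega, _root_.le_refl _⟩, hn⟩
    · simp only [Finset.mem_image, Finset.mem_Icc, not_exists, not_and, and_imp]
      intro m h1 h2 e
      apply hmin (n - m) (by omega)
      have : (θ ^ (n - m)) ((θ ^ m) j) = l := by
        rw [← Equiv.Perm.mul_apply, ← pow_add, Nat.sub_add_cancel h2, hn]
      rwa [e] at this
    · simp only [Finset.mem_image, Finset.mem_Icc]
      rintro k ⟨m, ⟨h1, h2⟩, rfl⟩
      by_cases hm : m = n
      · refine ⟨1, ⟨_root_.le_refl _, by omega⟩, ?_⟩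
        rw [hm, hn]; simp
      · refine ⟨m + 1, ⟨by omega, by omega⟩, ?_⟩
        have hl : (θ ^ m) j ≠ l := hmin m (by omega)
        have hj : (θ ^ m) j ≠ j := by
          intro e
          apply hmin (n - m) (by omega)
          have : (θ ^ (n - m)) ((θ ^ m) j) = l := by
            rw [← Equiv.Perm.mul_apply, ← pow_add, Nat.sub_add_cancel h2, hn]
          rwa [e] at this
        rw [Equiv.Perm.mul_apply, Equiv.swap_apply_of_ne_of_ne hj hl, pow_succ',
          Equiv.Perm.mul_apply]
  · left
    push Not at h
    refine ⟨Finset.univ.filter fun k => ∃ m : ℕ, (θ ^ m) j = k, ?_, ?_, ?_⟩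
    · simp; exact ⟨0, rfl⟩
    · simpa using h
    · simp only [Finset.mem_filter, Finset.mem_univ, true_and]
      rintro k ⟨m, rfl⟩
      exact ⟨m + 1, by rw [pow_succ', Equiv.Perm.mul_apply]⟩

/-- Switch two permutations on a set. -/
theorem exists_switch (p q : Equiv.Perm ι) (O : Finset ι) (h : ∀ k ∈ O, (q⁻¹ * p) k ∈ O) :
    ∃ r : Equiv.Perm ι, ∀ k, r k = if k ∈ O then p k else q k := by
  classical
  have hinj : Function.Injective fun k => if k ∈ O then p k else q k := by
    have hsurj : ∀ y ∈ O, ∃ x ∈ O, (q⁻¹ * p) x = y := by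
      have := Finset.surj_on_of_inj_on_of_card_le (s := O) (t := O) (fun a _ => (q⁻¹ * p) a) h
        (fun a b _ _ e => (q⁻¹ * p).injective e) (_root_.le_refl _)
      intro y hy
      obtain ⟨x, hx, e⟩ := this y hy
      exact ⟨x, hx, e.symm⟩
    have key : ∀ a ∈ O, ∀ b, b ∉ O → p a ≠ q b := by
      intro a ha b hb e
      apply hb
      have := h a ha
      rw [Equiv.Perm.mul_apply, e] at this
      simpa using this
    intro a b e
    dsimp at e
    split_ifs at e with h1 h2 h2
    · exact p.injective e
    · exact absurd e (key a h1 b h2)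
    · exact absurd e.symm (key b h2 a h1)
    · exact q.injective e
  exact ⟨Equiv.ofBijective _ (Finite.injective_iff_bijective.1 hinj), fun k => rfl⟩

theorem exists_switch' (p q : Equiv.Perm ι) (O : Finset ι) (h : ∀ k ∈ O, (q⁻¹ * p) k ∈ O) :
    ∃ r : Equiv.Perm ι, ∀ k, r k = if k ∈ O then q k else p k := by
  obtain ⟨r, hr⟩ := exists_switch p q O h
  refine ⟨p * r⁻¹ * q, fun k => ?_⟩
  simp only [Equiv.Perm.mul_apply]
  split_ifs with hk
  · obtain ⟨x, hx, e⟩ := Finset.surj_on_of_inj_on_of_card_le (s := O) (t := O)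
      (fun a _ => (q⁻¹ * p) a) h
      (fun a b _ _ e => (q⁻¹ * p).injective e) (_root_.le_refl _) k hk
    have h1 : q k = p x := by rw [e]; simp
    have h2 : r x = p x := by rw [hr, if_pos hx]
    have h3 : r⁻¹ (q k) = x := by rw [h1, ← h2]; simp
    rw [h3, h1]
  · have : r k = q k := by rw [hr, if_neg hk]
    rw [← this]; simp

/-- Rearranging two partial permutations and an edge. -/
theorem exists_rearrange {R : Type*} [CommSemiring R] (A : ι → ι → R) (p q : Equiv.Perm ι)
    (j l : ι) (hjl : j ≠ l) :
    ∃ s t : Equiv.Perm ι, t l = p j ∧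
      (∏ i, if i = j then 1 else A i (p i)) * A j (q l) * (∏ i, if i = l then 1 else A i (q i)) =
      (∏ i, A i (s i)) * ∏ i, if i = l then 1 else A i (t i) := by
  have e0 : A j (q l) = ∏ i, if i = j then A j (q l) else 1 := by simp
  have hlj := hjl.symm
  rcases exists_split (q⁻¹ * p) j l hjl with ⟨O, hj, hl, hO⟩ | ⟨O, hl, hj, hO⟩
  · obtain ⟨r, hr⟩ := exists_switch p q O hO
    obtain ⟨r', hr'⟩ := exists_switch' p q O hO
    refine ⟨r', r * Equiv.swap j l, by simp [hr, hj], ?_⟩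
    rw [e0, ← Finset.prod_mul_distrib, ← Finset.prod_mul_distrib, ← Finset.prod_mul_distrib]
    refine Finset.prod_congr rfl fun i _ => ?_
    by_cases h1 : i = j
    · subst h1; simp [hr, hr', hj, hl, hjl, mul_comm]
    by_cases h2 : i = l
    · subst h2; simp [hr', hl, hlj]
    by_cases h3 : i ∈ O <;>
      simp [hr, hr', h1, h2, h3, Equiv.swap_apply_of_ne_of_ne, mul_comm]
  · rw [mul_assoc] at hO
    obtain ⟨r', hr'⟩ := exists_switch (p * Equiv.swap j l) q O hO
    obtain ⟨r, hr⟩ := exists_switch' (p * Equiv.swap j l) q O hO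
    refine ⟨r * Equiv.swap j l, r', by simp [hr', hl], ?_⟩
    rw [e0, ← Finset.prod_mul_distrib, ← Finset.prod_mul_distrib, ← Finset.prod_mul_distrib]
    refine Finset.prod_congr rfl fun i _ => ?_
    by_cases h1 : i = j
    · subst h1; simp [hr, hr', hj, hl, hjl]
    by_cases h2 : i = l
    · subst h2; simp [hr, hj, hlj]
    by_cases h3 : i ∈ O <;>
      simp [hr, hr', h1, h2, h3, Equiv.swap_apply_of_ne_of_ne, mul_comm]

/-- The product of all entries along `τ` except at row `j`. -/
def D {R : Type*} [CommSemiring R] (A : ι → ι → R) (τ : Equiv.Perm ι) (j : ι) : R :=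
  ∏ i, if i = j then 1 else A i (τ i)

theorem mul_D {R : Type*} [CommSemiring R] (A : ι → ι → R) (τ : Equiv.Perm ι) (j : ι) :
    A j (τ j) * D A τ j = ∏ i, A i (τ i) := by
  have e0 : A j (τ j) = ∏ i, if i = j then A j (τ j) else 1 := by simp
  rw [e0, D, ← Finset.prod_mul_distrib]
  refine Finset.prod_congr rfl fun i _ => ?_
  by_cases h : i = j
  · subst h; simp
  · simp [h]

theorem D_le {R : Type*} [SupertropicalSemifield R] (C : ι → ι → R)
    (h1 : ∀ i, nuLe 1 (C i i)) (h1' : ∀ i, nuLe (C i i) 1)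
    (ht : ∀ i j k, nuLe (C i j * C j k) (C i k)) :
    ∀ (N : ℕ) (τ : Equiv.Perm ι), τ.support.card < N → ∀ j, nuLe (D C τ j) (C (τ j) j) := by
  intro N
  induction N with
  | zero => intro τ h; omega
  | succ N ih =>
    intro τ hτ
    have moved : ∀ j, τ j ≠ j → nuLe (D C τ j) (C (τ j) j) := by
      intro j hj
      set i := τ j with hi
      have hii : τ i ≠ i := fun e => hj (τ.injective (by rw [e, hi]))
      have hlt := Equiv.Perm.card_support_swap_mul hii
      have := ih (Equiv.swap i (τ i) * τ) (by omega) j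
      have hj' : (Equiv.swap i (τ i) * τ) j = τ i := by simp [← hi]
      rw [hj'] at this
      have e : C i i * D C τ j = C i (τ i) * D C (Equiv.swap i (τ i) * τ) j := by
        have e1 : C i i = ∏ k, if k = i then C i i else 1 := by simp
        have e2 : C i (τ i) = ∏ k, if k = i then C i (τ i) else 1 := by simp
        rw [e1, e2, D, D, ← Finset.prod_mul_distrib, ← Finset.prod_mul_distrib]
        refine Finset.prod_congr rfl fun k _ => ?_
        by_cases h : k = i
        · subst h; simp [hj, mul_comm]
        by_cases h' : k = j
        · subst h'; simp [h]
        · have a1 : τ k ≠ i := fun e => h' (τ.injective (by rw [e, hi]))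
          have a2 : τ k ≠ τ i := fun e => h (τ.injective e)
          simp [h, h', Equiv.swap_apply_of_ne_of_ne a1 a2]
      calc nuLe (D C τ j) (C i i * D C τ j) := by
            simpa using mul_le_r (h1 i) (D C τ j)
        nuLe _ (C i (τ i) * C (τ i) j) := by rw [e]; exact mul_le_l this _
        nuLe _ (C i j) := ht _ _ _
    intro j
    by_cases hj : τ j = j
    · rw [hj]
      refine le_trans ?_ (h1 j)
      have hf : nuLe (D C τ j) (∏ i, C i (τ i)) := by
        rw [← mul_D C τ j, hj]
        simpa using mul_le_r (h1 j) (D C τ j)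
      refine le_trans hf ?_
      by_cases hall : ∀ k, τ k = k
      · simp only [hall]
        simpa using prod_le Finset.univ (fun i => C i i) (fun _ => 1) (fun i _ => h1' i)
      · push Not at hall
        obtain ⟨k, hk⟩ := hall
        rw [← mul_D C τ k]
        exact le_trans (mul_le_l (moved k hk) _) (le_trans (ht _ _ _) (h1' _))
    · exact moved j hj

end comb
end STP
namespace STP
open ST SupertropicalSemiring

section lap
variable {R : Type*} [CommSemiring R] {n : ℕ}

theorem per_eq (A : Matrix (Fin n) (Fin n) R) :
    per A = ∑ σ : Equiv.Perm (Fin n), ∏ i, A i (σ i) := by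
  unfold per
  simp only [List.prod_ofFn]

/-- The permutation sending `j` to `i` and otherwise given by `π`. -/
def ins (j i : Fin (n + 1)) (π : Equiv.Perm (Fin n)) : Equiv.Perm (Fin (n + 1)) :=
  (finSuccEquiv' j).trans ((Equiv.optionCongr π).trans (finSuccEquiv' i).symm)

theorem ins_self (j i : Fin (n + 1)) (π : Equiv.Perm (Fin n)) : ins j i π j = i := by
  simp [ins]

theorem ins_succ (j i : Fin (n + 1)) (π : Equiv.Perm (Fin n)) (k : Fin n) :
    ins j i π (j.succAbove k) = i.succAbove (π k) := by
  simp [ins]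

theorem ins_bij (j : Fin (n + 1)) :
    Function.Bijective (fun x : Fin (n + 1) × Equiv.Perm (Fin n) => ins j x.1 x.2) := by
  rw [Fintype.bijective_iff_injective_and_card]
  constructor
  · rintro ⟨i, π⟩ ⟨i', π'⟩ h
    dsimp at h
    have h0 : i = i' := by rw [← ins_self j i π, h, ins_self]
    subst h0
    congr 1
    ext k
    have := ins_succ j i π k
    rw [h, ins_succ] at this
    rw [Fin.succAbove_right_injective this]
  · simp [Fintype.card_perm, Nat.factorial_succ]

theorem D_ins (A : Matrix (Fin (n + 1)) (Fin (n + 1)) R) (j i : Fin (n + 1))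
    (π : Equiv.Perm (Fin n)) :
    D A (ins j i π) j = ∏ k, A (j.succAbove k) (i.succAbove (π k)) := by
  unfold D
  rw [Fin.prod_univ_succAbove _ j]
  simp [ins_succ]

theorem adj_eq (A : Matrix (Fin (n + 1)) (Fin (n + 1)) R) (i j : Fin (n + 1)) :
    adj A i j = ∑ π : Equiv.Perm (Fin n), D A (ins j i π) j := by
  unfold adj
  rw [per_eq]
  simp [D_ins]

theorem laplace_row (A : Matrix (Fin (n + 1)) (Fin (n + 1)) R) (j : Fin (n + 1)) :
    ∑ i, A j i * adj A i j = per A := by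
  rw [per_eq, ← (ins_bij j).sum_comp, Fintype.sum_prod_type]
  refine Finset.sum_congr rfl fun i _ => ?_
  rw [adj_eq, Finset.mul_sum]
  refine Finset.sum_congr rfl fun π _ => ?_
  have := mul_D A (ins j i π) j
  rw [ins_self] at this
  exact this

theorem per_transpose (A : Matrix (Fin n) (Fin n) R) : per A.transpose = per A := by
  rw [per_eq, per_eq, ← Equiv.sum_comp (Equiv.inv (Equiv.Perm (Fin n)))]
  refine Finset.sum_congr rfl fun σ _ => ?_
  rw [← Equiv.prod_comp σ]
  simp

theorem laplace_col (A : Matrix (Fin (n + 1)) (Fin (n + 1)) R) (i : Fin (n + 1)) :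
    ∑ k, adj A i k * A k i = per A := by
  rw [← per_transpose A, ← laplace_row _ i]
  refine Finset.sum_congr rfl fun k _ => ?_
  rw [mul_comm]
  congr 1
  unfold adj
  rw [← per_transpose]
  rfl

theorem offdiag (A : Matrix (Fin (n + 1)) (Fin (n + 1)) R) (i j : Fin (n + 1)) :
    ∑ m, A i m * adj A m j = per (A.updateRow j (A i)) := by
  rw [← laplace_row _ j]
  refine Finset.sum_congr rfl fun m _ => ?_
  rw [Matrix.updateRow_self]
  congr 1
  unfold adj
  congr 1
  ext a b
  simp

end lap

section main
variable {R : Type*} [SupertropicalSemifield R] {n : ℕ}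

theorem offdiag_ghost (A : Matrix (Fin (n + 1)) (Fin (n + 1)) R) (i j : Fin (n + 1))
    (hij : i ≠ j) : ghost (∑ m, A i m * adj A m j) := by
  rw [offdiag, per_eq]
  set M := A.updateRow j (A i) with hM
  obtain ⟨σ, hσ, h⟩ := exists_max Finset.univ Finset.univ_nonempty
    (fun σ : Equiv.Perm (Fin (n + 1)) => ∏ k, M k (σ k))
  refine ghost_sum _ _ σ (σ * Equiv.swap i j) hσ (Finset.mem_univ _) ?_ h ?_
  · intro e
    have := congrArg (fun τ : Equiv.Perm (Fin (n + 1)) => τ i) e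
    simp at this
    exact hij this
  · have : ∏ k, M k (σ k) = ∏ k, M k ((σ * Equiv.swap i j) k) := by
      rw [← Equiv.prod_comp (Equiv.swap i j)]
      refine Finset.prod_congr rfl fun k _ => ?_
      rw [Equiv.Perm.mul_apply]
      have hr : M i = M j := by
        rw [hM, Matrix.updateRow_self, Matrix.updateRow_ne hij]
      by_cases h1 : k = i
      · subst h1; simp [hr]
      by_cases h2 : k = j
      · subst h2; simp [hr]
      rw [Equiv.swap_apply_of_ne_of_ne h1 h2]
    rw [← this]; exact le_refl _

theorem D_le_adj (A : Matrix (Fin (n + 1)) (Fin (n + 1)) R) (τ : Equiv.Perm (Fin (n + 1)))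
    (j : Fin (n + 1)) : nuLe (D A τ j) (adj A (τ j) j) := by
  obtain ⟨⟨i, π⟩, rfl⟩ := (ins_bij j).2 τ
  dsimp
  rw [ins_self, adj_eq]
  exact le_sum Finset.univ (fun π => D A (ins j i π) j) π (Finset.mem_univ _)

theorem adj_le_D (A : Matrix (Fin (n + 1)) (Fin (n + 1)) R) (i j : Fin (n + 1)) :
    ∃ τ : Equiv.Perm (Fin (n + 1)), τ j = i ∧ nuLe (adj A i j) (D A τ j) := by
  rw [adj_eq]
  obtain ⟨π, _, h⟩ := sum_attained Finset.univ Finset.univ_nonempty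
    (fun π => D A (ins j i π) j)
  exact ⟨_, ins_self j i π, h⟩

theorem prod_le_per (A : Matrix (Fin n) (Fin n) R) (τ : Equiv.Perm (Fin n)) :
    nuLe (∏ i, A i (τ i)) (per A) := by
  rw [per_eq]
  exact le_sum Finset.univ (fun τ : Equiv.Perm (Fin n) => ∏ i, A i (τ i)) τ (Finset.mem_univ _)

theorem per_le_prod (A : Matrix (Fin n) (Fin n) R) :
    ∃ τ : Equiv.Perm (Fin n), nuLe (per A) (∏ i, A i (τ i)) := by
  rw [per_eq]
  obtain ⟨π, _, h⟩ := sum_attained Finset.univ Finset.univ_nonempty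
    (fun τ : Equiv.Perm (Fin n) => ∏ i, A i (τ i))
  exact ⟨π, h⟩

theorem mul_adj_le (A : Matrix (Fin (n + 1)) (Fin (n + 1)) R) (j m : Fin (n + 1)) :
    nuLe (A j m * adj A m j) (per A) := by
  rw [← laplace_row A j]
  exact le_sum Finset.univ (fun i => A j i * adj A i j) m (Finset.mem_univ _)

theorem adj_mul_adj (A : Matrix (Fin (n + 1)) (Fin (n + 1)) R) (k j m l : Fin (n + 1)) :
    nuLe (adj A k j * A j m * adj A m l) (per A * adj A k l) := by
  by_cases hjl : j = l
  · subst hjl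
    rw [mul_assoc, mul_comm]
    exact mul_le_r (mul_adj_le A j m) _
  obtain ⟨p, hp, h1⟩ := adj_le_D A k j
  obtain ⟨q, hq, h2⟩ := adj_le_D A m l
  refine le_trans (mul_le (mul_le_r h1 _) h2) ?_
  obtain ⟨s, t, ht, e⟩ := exists_rearrange A p q j l hjl
  rw [hq] at e
  rw [hp] at ht
  unfold D
  rw [e]
  have := D_le_adj A t l
  rw [ht] at this
  exact mul_le (prod_le_per A s) this

end main
end STP
namespace STP
open ST SupertropicalSemiring

section core
variable {R : Type*} [SupertropicalSemifield R] {n : ℕ}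

theorem le_of_eq {a b : R} (h : a = b) : nuLe a b := by rw [h]; exact le_refl b

theorem shift_D {ι : Type*} [Fintype ι] [DecidableEq ι] (B C : ι → ι → R) (c : ι → R)
    (σ ρ : Equiv.Perm ι)
    (hC : ∀ i j, C i j = c i * B (σ i) j) (l : ι) :
    (∏ i, c i) * D B ρ (σ l) = c l * D C (ρ * σ) l := by
  have e0 : c l = ∏ i, if i = l then c l else 1 := by simp
  rw [e0]
  unfold D
  rw [← Equiv.prod_comp σ (fun i => if i = σ l then 1 else B i (ρ i)),
    ← Finset.prod_mul_distrib, ← Finset.prod_mul_distrib]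
  refine Finset.prod_congr rfl fun i _ => ?_
  by_cases h : i = l
  · subst h; simp
  · simp [h, hC]

/-- The order-theoretic content. -/
theorem core (A B : Matrix (Fin (n + 1)) (Fin (n + 1)) R) (u u' : R) (hu : per A * u = 1)
    (hB : ∀ i j, B i j + B i j = u * adj A i j + u * adj A i j)
    (hu' : per B * u' = 1) :
    ∃ (σ : Equiv.Perm (Fin (n + 1))) (C : Fin (n + 1) → Fin (n + 1) → R),
      (∀ i j k, nuLe (C i j * C j k) (C i k)) ∧
      (∀ i j, C i j = A i (σ i) * B (σ i) j) ∧
      (∀ i, nuLe 1 (C i i)) ∧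
      (∀ i m j, nuLe (A i m * B m j) (C i j)) ∧
      (∀ i l, nuLe (u' * adj B i (σ l)) (C i l * A l (σ l))) ∧
      (∀ i l, nuLe (C i l * A l (σ l)) (u' * adj B i (σ l))) := by
  obtain ⟨σ, hσ⟩ := per_le_prod A
  have hσ' := prod_le_per A σ
  have B1 : ∀ i j, nuLe (B i j) (u * adj A i j) := fun i j => le_of_nuEq (hB i j)
  have B2 : ∀ i j, nuLe (u * adj A i j) (B i j) := fun i j => le_of_nuEq (hB i j).symm
  have F1 : ∀ i k, nuLe (A i k * B k i) 1 := fun i k =>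
    calc nuLe (A i k * B k i) (A i k * (u * adj A k i)) := mul_le_l (B1 _ _) _
      nuLe _ (u * (A i k * adj A k i)) := le_of_eq (by ring)
      nuLe _ (u * per A) := mul_le_l (mul_adj_le _ _ _) _
      nuLe _ 1 := le_of_eq (by rw [mul_comm, hu])
  have F2 : ∀ k j m l, nuLe (B k j * A j m * B m l) (B k l) := fun k j m l =>
    calc nuLe (B k j * A j m * B m l) ((u * adj A k j) * A j m * (u * adj A m l)) :=
          mul_le (mul_le_r (B1 _ _) _) (B1 _ _)
      nuLe _ (u * u * (adj A k j * A j m * adj A m l)) := le_of_eq (by ring)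
      nuLe _ (u * u * (per A * adj A k l)) := mul_le_l (adj_mul_adj _ _ _ _ _) _
      nuLe _ ((per A * u) * (u * adj A k l)) := le_of_eq (by ring)
      nuLe _ (u * adj A k l) := le_of_eq (by rw [hu, one_mul])
      nuLe _ (B k l) := B2 _ _
  have F3 : ∀ i, nuLe 1 (A i (σ i) * B (σ i) i) := fun i =>
    calc nuLe 1 (u * per A) := le_of_eq (by rw [mul_comm, hu])
      nuLe _ (u * ∏ i, A i (σ i)) := mul_le_l hσ _
      nuLe _ (u * (A i (σ i) * D A σ i)) := le_of_eq (congrArg (fun z => u * z) (mul_D A σ i).symm)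
      nuLe _ (u * (A i (σ i) * adj A (σ i) i)) := mul_le_l (mul_le_l (D_le_adj _ _ _) _) _
      nuLe _ (A i (σ i) * (u * adj A (σ i) i)) := le_of_eq (by ring)
      nuLe _ _ := mul_le_l (B2 _ _) _
  set c : Fin (n + 1) → R := fun i => A i (σ i) with hc
  set C : Fin (n + 1) → Fin (n + 1) → R := fun i j => c i * B (σ i) j with hCdef
  have hC : ∀ i j, C i j = c i * B (σ i) j := fun _ _ => rfl
  have C1 : ∀ i, nuLe 1 (C i i) := F3
  have C1' : ∀ i, nuLe (C i i) 1 := fun i => F1 i (σ i)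
  have CT : ∀ i j k, nuLe (C i j * C j k) (C i k) := fun i j k =>
    calc nuLe (C i j * C j k) (c i * (B (σ i) j * A j (σ j) * B (σ j) k)) :=
          le_of_eq (by simp only [hCdef, hc]; ring)
      nuLe _ (C i k) := mul_le_l (F2 _ _ _ _) _
  have CD : ∀ τ j, nuLe (D C τ j) (C (τ j) j) := fun τ j =>
    D_le C C1 C1' CT _ τ (Nat.lt_succ_self _) j
  have CP : ∀ τ : Equiv.Perm (Fin (n + 1)), nuLe (∏ i, C i (τ i)) 1 := fun τ => by
    rw [← mul_D C τ 0]
    exact le_trans (mul_le_l (CD τ 0) _) (le_trans (CT _ _ _) (C1' _))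
  have prodB : ∀ ρ : Equiv.Perm (Fin (n + 1)),
      (∏ i, c i) * ∏ i, B i (ρ i) = ∏ i, C i ((ρ * σ) i) := fun ρ => by
    rw [← Equiv.prod_comp σ (fun i => B i (ρ i)), ← Finset.prod_mul_distrib]
    rfl
  -- comparison of `u'` and `per A`
  have U1 : nuLe u' (∏ i, c i) := by
    have h1 : nuLe 1 ((∏ i, c i) * per B) :=
      calc nuLe 1 (∏ i, C i i) := by
            simpa using prod_le Finset.univ (fun _ => 1) (fun i => C i i) (fun i _ => C1 i)
        nuLe _ ((∏ i, c i) * ∏ i, B i (σ⁻¹ i)) := le_of_eq (by rw [prodB]; simp)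
        nuLe _ _ := mul_le_l (prod_le_per _ _) _
    calc nuLe u' (1 * u') := le_of_eq (by ring)
      nuLe _ ((∏ i, c i) * per B * u') := mul_le_r h1 _
      nuLe _ _ := le_of_eq (by rw [mul_assoc, hu', mul_one])
  have U2 : nuLe (∏ i, c i) u' := by
    obtain ⟨ρ, hρ⟩ := per_le_prod B
    have h1 : nuLe ((∏ i, c i) * per B) 1 :=
      le_trans (mul_le_l hρ _) (by rw [prodB]; exact CP _)
    calc nuLe (∏ i, c i) ((∏ i, c i) * per B * u') := le_of_eq (by rw [mul_assoc, hu', mul_one])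
      nuLe _ (1 * u') := mul_le_r h1 _
      nuLe _ _ := le_of_eq (by ring)
  refine ⟨σ, C, CT, hC, C1, ?_, ?_, ?_⟩
  · intro i m j
    calc nuLe (A i m * B m j) (1 * (A i m * B m j)) := le_of_eq (by ring)
      nuLe _ (C i i * (A i m * B m j)) := mul_le_r (C1 i) _
      nuLe _ (c i * (B (σ i) i * A i m * B m j)) := le_of_eq (by simp only [hCdef]; ring)
      nuLe _ (C i j) := mul_le_l (F2 _ _ _ _) _
  · intro i l
    obtain ⟨ρ, hρ, h⟩ := adj_le_D B i (σ l)
    have h2 := CD (ρ * σ) l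
    rw [Equiv.Perm.mul_apply, hρ] at h2
    calc nuLe (u' * adj B i (σ l)) ((∏ i, c i) * D B ρ (σ l)) := mul_le U1 h
      nuLe _ (c l * D C (ρ * σ) l) := le_of_eq (shift_D B C c σ ρ hC l)
      nuLe _ (c l * C i l) := mul_le_l h2 _
      nuLe _ _ := le_of_eq (mul_comm _ _)
  · intro i l
    have hd : nuLe (C i l) (D C (Equiv.swap i l) l) := by
      by_cases hil : i = l
      · subst hil
        refine le_trans (C1' i) ?_
        unfold D
        have := prod_le Finset.univ (fun _ => 1)
          (fun k => if k = i then 1 else C k ((Equiv.swap i i) k)) (fun k _ => by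
            split_ifs
            · exact le_refl _
            · simpa using C1 k)
        simpa using this
      · have e0 : C i l = ∏ k, if k = i then C i l else 1 := by simp
        rw [e0]
        unfold D
        refine prod_le _ _ _ fun k _ => ?_
        by_cases h1 : k = i
        · subst h1; simp [hil]; exact le_refl _
        by_cases h2 : k = l
        · subst h2; simp [h1]; exact le_refl _
        · simp only [h1, h2, if_false, Equiv.swap_apply_of_ne_of_ne h1 h2]
          exact C1 k
    have h2 := D_le_adj B (Equiv.swap i l * σ⁻¹) (σ l)
    have h3 : (Equiv.swap i l * σ⁻¹) (σ l) = i := by simp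
    rw [h3] at h2
    calc nuLe (C i l * A l (σ l)) (c l * D C (Equiv.swap i l) l) := by
          rw [mul_comm]; exact mul_le_l hd _
      nuLe _ ((∏ i, c i) * D B (Equiv.swap i l * σ⁻¹) (σ l)) :=
          le_of_eq (by rw [shift_D B C c σ _ hC l, inv_mul_cancel_right])
      nuLe _ _ := mul_le U2 h2

end core
end STP

/-- For quasi-invertible `A`, `(A^ν̂∇)^ν̂∇ · A^ν̂∇ = I_A`. -/
theorem left_quasi_identity_of_tangible_nabla {R : Type*} [SupertropicalSemifield R]
    (f : ST.TangibleRetract R) {n : ℕ} (A : Matrix (Fin (n + 1)) (Fin (n + 1)) R)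
    (hA : ST.tangible (ST.per A)) (u : R) (hu : ST.per A * u = 1) :
    ∀ u' : R, ST.per (u • (ST.adj A).map f) * u' = 1 →
      (u' • (ST.adj (u • (ST.adj A).map f)).map f) * (u • (ST.adj A).map f)
        = A * (u • ST.adj A) := by
  intro u' hu'
  have hB : ∀ i j, (u • (ST.adj A).map f) i j + (u • (ST.adj A).map f) i j
      = u * ST.adj A i j + u * ST.adj A i j := by
    intro i j
    simp only [Matrix.smul_apply, Matrix.map_apply, smul_eq_mul]
    rw [← mul_add, STP.retract_nu, mul_add]
  set B := u • (ST.adj A).map f with hBdef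
  clear_value B
  have hR : ∀ i j, (A * (u • ST.adj A)) i j = u * ∑ m, A i m * ST.adj A m j := by
    intro i j
    rw [Matrix.mul_apply, Finset.mul_sum]
    refine Finset.sum_congr rfl fun m _ => ?_
    rw [Matrix.smul_apply, smul_eq_mul]
    exact mul_left_comm (A i m) u (ST.adj A m j)
  obtain ⟨σ, C, CT, hC, C1, hAB, E1, E2⟩ := STP.core A B u u' hu hB hu'
  have nf : ∀ a b : R, f a * b + f a * b = a * b + a * b := fun a b => by
    rw [← add_mul, STP.retract_nu, add_mul]
  ext i j
  rw [hR]
  have hL : ((u' • (ST.adj B).map f) * B) i j = u' * ∑ k, f (ST.adj B i k) * B k j := by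
    rw [Matrix.mul_apply, Finset.mul_sum]
    refine Finset.sum_congr rfl fun m _ => ?_
    rw [Matrix.smul_apply, smul_eq_mul, Matrix.map_apply, mul_assoc]
  by_cases hij : i = j
  · subst hij
    rw [hL]
    have hBt : ST.tangible (ST.per B) := fun hg => by
      have := SupertropicalSemiring.ghost_mul_right u' hg
      rw [hu'] at this
      exact SupertropicalDomain.one_tangible this
    have hcol : ∑ k, ST.adj B i k * B k i = ST.per B := STP.laplace_col B i
    have hrow : ∑ k, A i k * ST.adj A k i = ST.per A := STP.laplace_row A i
    rw [hrow, STP.sum_replace Finset.univ (fun k => ST.adj B i k * B k i), hcol,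
      mul_comm u', hu', mul_comm u, hu]
    · rw [hcol]; exact hBt
    · intro k; exact (nf _ _).symm
    · intro k hk
      have : ST.tangible (ST.adj B i k) := fun hg =>
        hk (SupertropicalSemiring.ghost_mul_right _ hg)
      rw [f.id_on_T0 _ (Or.inr this)]
  · -- off-diagonal: both sides are ghosts of the same value
    set x : Fin (n + 1) → R := fun k => u' * (f (ST.adj B i k) * B k j) with hx
    have hL' : u' * ∑ k, f (ST.adj B i k) * B k j = ∑ k, x k := by
      rw [Finset.mul_sum]
    rw [hL, hL']
    have x1 : ∀ k, ST.nuLe (x k) (u' * ST.adj B i k * B k j) := fun k => by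
      rw [mul_assoc]; exact STP.mul_le_l (STP.le_of_nuEq (nf _ _)) _
    have x2 : ∀ k, ST.nuLe (u' * ST.adj B i k * B k j) (x k) := fun k => by
      rw [mul_assoc]; exact STP.mul_le_l (STP.le_of_nuEq (nf _ _).symm) _
    have up : ∀ k, ST.nuLe (x k) (C i j) := by
      intro k
      obtain ⟨l, rfl⟩ := σ.surjective k
      refine STP.le_trans (x1 _) (STP.le_trans (STP.mul_le_r (E1 i l) _) ?_)
      rw [mul_assoc, ← hC]
      exact CT _ _ _
    have lo1 : ST.nuLe (C i j) (x (σ i)) := by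
      refine STP.le_trans ?_ (STP.le_trans (STP.mul_le_r (E2 i i) _) (x2 _))
      rw [mul_assoc, ← hC]
      simpa using STP.mul_le_r (C1 i) (C i j)
    have lo2 : ST.nuLe (C i j) (x (σ j)) := by
      refine STP.le_trans ?_ (STP.le_trans (STP.mul_le_r (E2 i j) _) (x2 _))
      rw [mul_assoc, ← hC]
      simpa using STP.mul_le_l (C1 j) (C i j)
    have gL : ST.ghost (∑ k, x k) :=
      STP.ghost_sum Finset.univ x (σ i) (σ j) (Finset.mem_univ _) (Finset.mem_univ _)
        (fun e => hij (σ.injective e)) (fun k _ => STP.le_trans (up k) lo1)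
        (STP.le_trans (up _) lo2)
    have gR : ST.ghost (u * ∑ m, A i m * ST.adj A m j) :=
      SupertropicalSemiring.ghost_mul_left _ (STP.offdiag_ghost A i j hij)
    have L1 : ST.nuLe (∑ k, x k) (C i j) := STP.sum_le _ _ _ fun k _ => up k
    have L2 : ST.nuLe (C i j) (∑ k, x k) :=
      STP.le_trans lo1 (STP.le_sum Finset.univ x (σ i) (Finset.mem_univ _))
    have hS : u * ∑ m, A i m * ST.adj A m j = ∑ m, A i m * (u * ST.adj A m j) := by
      rw [Finset.mul_sum]
      exact Finset.sum_congr rfl fun m _ => mul_left_comm u (A i m) (ST.adj A m j)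
    have R1 : ST.nuLe (u * ∑ m, A i m * ST.adj A m j) (C i j) := by
      rw [hS]
      exact STP.sum_le _ _ _ fun m _ => STP.le_trans
        (STP.mul_le_l (STP.le_of_nuEq (hB m j).symm) _) (hAB i m j)
    have R2 : ST.nuLe (C i j) (u * ∑ m, A i m * ST.adj A m j) := by
      rw [hS, hC]
      exact STP.le_trans (STP.mul_le_l (STP.le_of_nuEq (hB (σ i) j)) _)
        (STP.le_sum Finset.univ (fun m => A i m * (u * ST.adj A m j)) (σ i) (Finset.mem_univ _))
    exact STP.ghost_eq gL gR (STP.le_trans L1 R2) (STP.le_trans R1 L2)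
end

section
/- (Supertropical Cramer's rule) Let A be a quasi-invertible n×n matrix over a supertropical semifield and v a tangible vector. Then x = ν̂(A^∇ v) is a tangible vector satisfying A x ghost-surpasses v, i.e., A x = v + ghost. -/
namespace STProof

section Perm
variable {R : Type*} [CommSemiring R]

lemma per_eq {n : ℕ} (A : Matrix (Fin n) (Fin n) R) :
    ST.per A = ∑ σ : Equiv.Perm (Fin n), ∏ i, A i (σ i) := by
  unfold ST.per
  refine Finset.sum_congr rfl fun σ _ => ?_
  rw [List.prod_ofFn]

/-- the permutation sending `j` to `l` and acting as `ρ` elsewhere -/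
def glue {n : ℕ} (j : Fin (n + 1)) (p : Fin (n + 1) × Equiv.Perm (Fin n)) :
    Equiv.Perm (Fin (n + 1)) :=
  (finSuccEquiv' j).trans ((Equiv.optionCongr p.2).trans (finSuccEquiv' p.1).symm)

lemma glue_self {n : ℕ} (j : Fin (n + 1)) (p : Fin (n + 1) × Equiv.Perm (Fin n)) :
    glue j p j = p.1 := by simp [glue]

lemma glue_succ {n : ℕ} (j : Fin (n + 1)) (p : Fin (n + 1) × Equiv.Perm (Fin n)) (r : Fin n) :
    glue j p (j.succAbove r) = p.1.succAbove (p.2 r) := by simp [glue]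

lemma glue_bij {n : ℕ} (j : Fin (n + 1)) : Function.Bijective (glue (n := n) j) := by
  rw [Fintype.bijective_iff_injective_and_card]
  constructor
  · rintro ⟨l, ρ⟩ ⟨l', ρ'⟩ h
    have h1 : l = l' := by
      have := congrArg (fun e => e j) h
      simpa only [glue_self] using this
    subst h1
    have h2 : ρ = ρ' := by
      ext1 r
      have := congrArg (fun e => e (j.succAbove r)) h
      simp only [glue_succ] at this
      exact Fin.succAbove_right_injective this
    rw [h2]
  · simp [Fintype.card_perm, Nat.factorial_succ]

lemma laplace {n : ℕ} (A : Matrix (Fin (n + 1)) (Fin (n + 1)) R) (j : Fin (n + 1))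
    (w : Fin (n + 1) → R) :
    ST.per (A.updateRow j w) = ∑ l, w l * ST.adj A l j := by
  rw [per_eq, ← (glue_bij j).sum_comp, Fintype.sum_prod_type]
  refine Finset.sum_congr rfl fun l _ => ?_
  unfold ST.adj
  rw [per_eq, Finset.mul_sum]
  refine Finset.sum_congr rfl fun ρ _ => ?_
  rw [Fin.prod_univ_succAbove _ j]
  simp [glue_self, glue_succ, Matrix.updateRow_self, Matrix.updateRow_ne, Fin.succAbove_ne]

end Perm

section Nu
variable {R : Type*} [SupertropicalSemiring R]
open SupertropicalSemiring

/-- the ν-preorder -/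
def le (a b : R) : Prop := (a + a) + (b + b) = b + b

lemma le_refl (a : R) : le a a := nu_idem a

lemma le_of_nu {a b : R} (h : a + a = b + b) : le a b := by
  unfold le; rw [h]; exact nu_idem b

lemma le_trans {a b c : R} (h : le a b) (h' : le b c) : le a c := by
  unfold le at *
  rw [← h', ← add_assoc, h]

lemma le_total (a b : R) : le a b ∨ le b a := by
  by_cases h : a + a = b + b
  · exact Or.inl (le_of_nu h)
  · rcases add_cases h with h | h
    · right; unfold le
      calc b + b + (a + a) = (a + b) + (a + b) := by abel
        _ = _ := by rw [h]
    · left; unfold le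
      calc a + a + (b + b) = (a + b) + (a + b) := by abel
        _ = _ := by rw [h]

lemma nu_of_le {a b : R} (h : le a b) (h' : le b a) : a + a = b + b := by
  unfold le at *
  rw [← h, add_comm (a + a), h']

lemma absorb {a b : R} (h : ¬ le b a) : a + b = b := by
  have hne : a + a ≠ b + b := fun e => h (le_of_nu e.symm)
  rcases add_cases hne with h1 | h1
  · exfalso; apply h; unfold le
    calc b + b + (a + a) = (a + b) + (a + b) := by abel
      _ = _ := by rw [h1]
  · exact h1

lemma zero_le (a : R) : le 0 a := by unfold le; simp

lemma le_add_right (a b : R) : le a (a + b) := by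
  unfold le
  calc a + a + (a + b + (a + b)) = ((a + a) + (a + a)) + (b + b) := by abel
    _ = (a + b) + (a + b) := by rw [nu_idem]; abel

lemma add_le {a b c : R} (h : le a c) (h' : le b c) : le (a + b) c := by
  unfold le at *
  calc a + b + (a + b) + (c + c) = (a + a) + ((b + b) + (c + c)) := by abel
    _ = _ := by rw [h', h]

lemma add_le_add {a b c d : R} (h : le a c) (h' : le b d) : le (a + b) (c + d) :=
  add_le (le_trans h (le_add_right _ _))
    (le_trans h' (by rw [add_comm]; exact le_add_right _ _))

lemma mul_le_left (c : R) {a b : R} (h : le a b) : le (c * a) (c * b) := by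
  unfold le at *
  rw [← mul_add, ← mul_add, ← mul_add, h]

lemma mul_le_right (c : R) {a b : R} (h : le a b) : le (a * c) (b * c) := by
  unfold le at *
  rw [← add_mul, ← add_mul, ← add_mul, h]

lemma sum_le {ι : Type*} (s : Finset ι) (f : ι → R) (c : R) (h : ∀ i ∈ s, le (f i) c) :
    le (∑ i ∈ s, f i) c := by
  classical
  exact Finset.sum_induction f (fun a => le a c) (fun _ _ => add_le) (zero_le c) h

lemma le_sum {ι : Type*} {s : Finset ι} (f : ι → R) {i : ι} (h : i ∈ s) :
    le (f i) (∑ i ∈ s, f i) := by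
  classical
  rw [← Finset.add_sum_erase s f h]
  exact le_add_right _ _

lemma sum_le_sum {ι : Type*} (s : Finset ι) (f g : ι → R) (h : ∀ i ∈ s, le (f i) (g i)) :
    le (∑ i ∈ s, f i) (∑ i ∈ s, g i) :=
  sum_le s f _ fun i hi => le_trans (h i hi) (le_sum g hi)

lemma exists_max {ι : Type*} (s : Finset ι) (hs : s.Nonempty) (f : ι → R) :
    ∃ k ∈ s, ∀ i ∈ s, le (f i) (f k) := by
  classical
  induction hs using Finset.Nonempty.cons_induction with
  | singleton a => exact ⟨a, by simp, by simp [le_refl]⟩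
  | cons a s ha hs ih =>
    obtain ⟨k, hk, hm⟩ := ih
    rcases le_total (f a) (f k) with h | h
    · refine ⟨k, by simp [hk], fun i hi => ?_⟩
      rcases Finset.mem_cons.1 hi with rfl | hi
      · exact h
      · exact hm i hi
    · refine ⟨a, by simp, fun i hi => ?_⟩
      rcases Finset.mem_cons.1 hi with rfl | hi
      · exact le_refl _
      · exact le_trans (hm i hi) h

lemma unique_max {ι : Type*} [DecidableEq ι] (s : Finset ι) (f : ι → R)
    (h : ¬ isGhost (∑ i ∈ s, f i)) :
    ∃ k ∈ s, ¬ le (f k) (∑ i ∈ s.erase k, f i) := by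
  have hs : s.Nonempty := by
    rw [Finset.nonempty_iff_ne_empty]
    rintro rfl
    exact h (by simpa using ghost_zero)
  obtain ⟨k, hk, hm⟩ := exists_max s hs f
  refine ⟨k, hk, fun hle => h ?_⟩
  have h2 : le (∑ i ∈ s.erase k, f i) (f k) :=
    sum_le _ _ _ fun i hi => hm i (Finset.mem_of_mem_erase hi)
  rw [← Finset.add_sum_erase s f hk, add_eq_nu (nu_of_le hle h2)]
  exact nu_ghost _

end Nu

section Main
variable {R : Type*} [SupertropicalSemifield R]
open SupertropicalSemiring

instance commSR : CommSemiring R :=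
  { (inferInstance : Semiring R) with mul_comm := SupertropicalDomain.mul_comm }

lemma ghost_nu {g : R} (h : isGhost g) : g + g = g := by
  by_cases h0 : g = 0
  · simp [h0]
  · obtain ⟨t, -, rfl⟩ := SupertropicalDomain.nu_onto h h0
    exact nu_idem t

lemma retract_nu (f : ST.TangibleRetract R) (a : R) : f a + f a = a + a := by
  by_cases h : isGhost a
  · rw [f.nu_section a h, ghost_nu h]
  · rw [f.id_on_T0 a (Or.inr h)]

lemma add_ghost {a g : R} (hg : isGhost g) (h : le a g) : a + g = g := by
  by_cases h' : le g a
  · rw [add_eq_nu (nu_of_le h h'), nu_of_le h h', ghost_nu hg]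
  · exact absorb h'

lemma swap_le {n : ℕ} (A : Matrix (Fin (n + 1)) (Fin (n + 1)) R) {i j : Fin (n + 1)}
    (hij : j ≠ i) (l : Fin (n + 1)) :
    le (A i l * ST.adj A l j) (∑ m ∈ Finset.univ.erase l, A i m * ST.adj A m j) := by
  have h1 : A i l * ST.adj A l j
      = ST.per (A.updateRow j (fun m => if m = l then A i m else 0)) := by
    rw [laplace]; simp
  have h2 : ∑ m ∈ Finset.univ.erase l, A i m * ST.adj A m j
      = ST.per (A.updateRow j (fun m => if m = l then 0 else A i m)) := by
    rw [laplace, ← Finset.add_sum_erase _ _ (Finset.mem_univ l)]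
    simp only [if_true, zero_mul, zero_add]
    refine Finset.sum_congr rfl fun m hm => ?_
    rw [if_neg (Finset.ne_of_mem_erase hm)]
  rw [h1, h2, per_eq, per_eq, ← Equiv.sum_comp (Equiv.mulRight (Equiv.swap i j))
    (fun σ : Equiv.Perm (Fin (n+1)) =>
      ∏ r, A.updateRow j (fun m => if m = l then 0 else A i m) r (σ r))]
  refine sum_le_sum _ _ _ fun τ _ => ?_
  have hi : i ∈ Finset.univ.erase j := by simp [hij.symm]
  rw [← Finset.mul_prod_erase _ _ (Finset.mem_univ j), ← Finset.mul_prod_erase _ _ hi,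
    ← Finset.mul_prod_erase _ _ (Finset.mem_univ j), ← Finset.mul_prod_erase _ _ hi]
  simp only [Equiv.coe_mulRight, Equiv.Perm.mul_apply, Equiv.swap_apply_left,
    Equiv.swap_apply_right, Matrix.updateRow_self, Matrix.updateRow_ne hij.symm]
  by_cases h : τ j = l
  · have h' : τ i ≠ l := fun e => hij (τ.injective (h.trans e.symm))
    rw [if_pos h, if_neg h']
    have : ∏ x ∈ (Finset.univ.erase j).erase i,
        A.updateRow j (fun m => if m = l then A i m else 0) x (τ x) =
        ∏ x ∈ (Finset.univ.erase j).erase i,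
        A.updateRow j (fun m => if m = l then 0 else A i m) x (τ (Equiv.swap i j x)) := by
      refine Finset.prod_congr rfl fun x hx => ?_
      simp only [Finset.mem_erase] at hx
      rw [Matrix.updateRow_ne hx.2.1, Matrix.updateRow_ne hx.2.1,
        Equiv.swap_apply_of_ne_of_ne hx.1 hx.2.1]
    rw [this]
    apply le_of_nu
    rw [mul_left_comm]
  · rw [if_neg h, zero_mul]
    exact zero_le _

end Main

end STProof

/-- Supertropical Cramer's rule: for quasi-invertible `A` and a
tangible vector `v`, the tangible vector `x = ν̂(A^∇ v)` satisfies
`A x ⊨ v`. -/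
theorem cramer_rule {R : Type*} [SupertropicalSemifield R]
    (f : ST.TangibleRetract R) {n : ℕ} (A : Matrix (Fin (n + 1)) (Fin (n + 1)) R)
    (hA : ST.tangible (ST.per A)) (u : R) (hu : ST.per A * u = 1)
    (v : Fin (n + 1) → R) (hv : ∀ i, ST.tangible0 (v i)) :
    (∀ i, ST.tangible0 (f ((u • ST.adj A).mulVec v i))) ∧
    (∀ i, ST.GS (A.mulVec (fun k => f ((u • ST.adj A).mulVec v k)) i) (v i)) := by
  classical
  refine ⟨fun i => f.mem_T0 _, fun i => ?_⟩
  set y := (u • ST.adj A).mulVec v with hy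
  let c : Fin (n + 1) → Fin (n + 1) → R := fun l j => u * v j * (A i l * ST.adj A l j)
  have hs : ∀ l, A i l * y l = ∑ j, c l j := by
    intro l
    simp only [hy, Matrix.mulVec, dotProduct, Matrix.smul_apply, smul_eq_mul, Finset.mul_sum, c]
    refine Finset.sum_congr rfl fun j _ => ?_
    ring
  have hvi : v i = ∑ l, c l i := by
    have h := STProof.laplace A i (A i)
    rw [Matrix.updateRow_eq_self] at h
    simp only [c]
    rw [← Finset.mul_sum, ← h]
    calc v i = (ST.per A * u) * v i := by rw [hu, one_mul]
      _ = _ := by ring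
  have hsw : ∀ l j, j ≠ i →
      STProof.le (c l j) (∑ m ∈ Finset.univ.erase l, A i m * y m) := by
    intro l j hj
    refine STProof.le_trans (STProof.mul_le_left (u * v j) (STProof.swap_le A hj l)) ?_
    rw [Finset.mul_sum]
    refine STProof.sum_le_sum _ _ _ fun m _ => ?_
    rw [hs m]
    exact STProof.le_sum (c m) (Finset.mem_univ j)
  have hts : ∀ l, A i l * f (y l) + A i l * f (y l) = A i l * y l + A i l * y l := by
    intro l
    rw [← mul_add, ← mul_add, STProof.retract_nu]
  have hle1 : ∀ l, STProof.le (A i l * f (y l)) (A i l * y l) :=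
    fun l => STProof.le_of_nu (hts l)
  have hle2 : ∀ l, STProof.le (A i l * y l) (A i l * f (y l)) :=
    fun l => STProof.le_of_nu (hts l).symm
  have hAx : A.mulVec (fun k => f (y k)) i = ∑ l, A i l * f (y l) := rfl
  rw [hAx]
  by_cases hg : ST.ghost (∑ l, A i l * f (y l))
  · refine ⟨_, hg, (STProof.add_ghost hg ?_).symm⟩
    rw [hvi]
    refine STProof.sum_le_sum _ _ _ fun l _ => STProof.le_trans ?_ (hle2 l)
    rw [hs l]
    exact STProof.le_sum (c l) (Finset.mem_univ i)
  · obtain ⟨k, hk, hmax⟩ := STProof.unique_max _ _ hg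
    have hmax' : ¬ STProof.le (A i k * y k) (∑ m ∈ Finset.univ.erase k, A i m * y m) :=
      fun h => hmax (STProof.le_trans (hle1 k) (STProof.le_trans h
        (STProof.sum_le_sum _ _ _ fun m _ => hle2 m)))
    set q := ∑ j ∈ Finset.univ.erase i, c k j with hq
    have hqR : STProof.le q (∑ m ∈ Finset.univ.erase k, A i m * y m) :=
      STProof.sum_le _ _ _ fun j hj => hsw k j (Finset.ne_of_mem_erase hj)
    have hsk : A i k * y k = c k i + q := by
      rw [hs k, hq, Finset.add_sum_erase _ _ (Finset.mem_univ i)]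
    have hck : A i k * y k = c k i := by
      rw [hsk, add_comm]
      apply STProof.absorb
      intro h
      apply hmax'
      rw [hsk]
      exact STProof.add_le (STProof.le_trans h hqR) hqR
    have hv' : v i = A i k * y k := by
      rw [hvi, ← Finset.add_sum_erase _ _ (Finset.mem_univ k), hck, add_comm]
      apply STProof.absorb
      intro h
      apply hmax'
      rw [hck]
      refine STProof.le_trans h (STProof.sum_le_sum _ _ _ fun m _ => ?_)
      rw [hs m]
      exact STProof.le_sum (c m) (Finset.mem_univ i)
    have hvt : ST.tangible (v i) := by
      rcases hv i with h | h
      · exfalso; apply hmax'; rw [← hv', h]; exact STProof.zero_le _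
      · exact h
    have hyk : ST.tangible (y k) := fun h =>
      hvt (by rw [hv']; exact SupertropicalSemiring.ghost_mul_left _ h)
    refine ⟨0, SupertropicalSemiring.ghost_zero, ?_⟩
    rw [← Finset.add_sum_erase _ _ (Finset.mem_univ k), add_comm, STProof.absorb hmax,
      f.id_on_T0 _ (Or.inr hyk), ← hv', add_zero]
end

section
/- (Maximality of the Cramer solution) Let A be a quasi-invertible matrix over a supertropical semifield and v a tangible vector. If x is any tangible vector with A x ghost-surpassing v, then x ≤_ν ν̂(A^∇ v) componentwise. -/
namespace CM

open ST SupertropicalSemiring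

/-- A supertropical semifield is a commutative semiring. -/
abbrev cs (R : Type*) [h : SupertropicalSemifield R] : CommSemiring R :=
  { (inferInstance : Semiring R) with mul_comm := SupertropicalDomain.mul_comm }

section basic
variable {R : Type*} [SupertropicalSemiring R]

lemma le_refl (a : R) : nuLe a a := nu_idem a

lemma le_trans {a b c : R} (h : nuLe a b) (h' : nuLe b c) : nuLe a c := by
  unfold nuLe at *
  rw [← h', ← add_assoc, h]

lemma mul_right {a b : R} (h : nuLe a b) (c : R) : nuLe (a * c) (b * c) := by
  unfold nuLe at *
  simp only [← add_mul, h]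

lemma mul_left {a b : R} (h : nuLe a b) (c : R) : nuLe (c * a) (c * b) := by
  unfold nuLe at *
  simp only [← mul_add, h]

lemma mul_le {a b c d : R} (h : nuLe a b) (h' : nuLe c d) : nuLe (a * c) (b * d) :=
  le_trans (mul_right h c) (mul_left h' b)

lemma add_of_not_le {a b : R} (h : ¬ nuLe a b) : a + b = a := by
  by_cases e : a + a = b + b
  · exact absurd (by unfold nuLe; rw [e]; exact nu_idem b) h
  · rcases add_cases e with h1 | h1
    · exact h1
    · refine absurd ?_ h
      unfold nuLe
      rw [add_add_add_comm, h1]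

lemma le_add_right (a b : R) : nuLe a (a + b) := by
  unfold nuLe
  rw [add_add_add_comm a b a b, ← add_assoc, nu_idem]

lemma le_total (a b : R) : nuLe a b ∨ nuLe b a := by
  by_cases h : nuLe a b
  · exact Or.inl h
  · right
    have := le_add_right b a
    rwa [add_comm, add_of_not_le h] at this

lemma le_sum {ι : Type*} [DecidableEq ι] (s : Finset ι) (w : ι → R) {a : ι} (ha : a ∈ s) :
    nuLe (w a) (∑ b ∈ s, w b) := by
  rw [← Finset.add_sum_erase s w ha]
  exact le_add_right _ _

lemma sum_tangible {ι : Type*} [DecidableEq ι] (s : Finset ι) (w : ι → R) :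
    tangible (∑ b ∈ s, w b) →
      ∃ a ∈ s, ∑ b ∈ s, w b = w a ∧ ∀ b ∈ s, b ≠ a → ¬ nuLe (w a) (w b) := by
  induction s using Finset.induction_on with
  | empty => intro h; exact absurd ghost_zero (by simpa using h)
  | insert b s hb ih =>
    rw [Finset.sum_insert hb]
    intro h
    by_cases e : nuLe (w b) (∑ c ∈ s, w c)
    · have e2 : ¬ nuLe (∑ c ∈ s, w c) (w b) := by
        intro e2
        apply h
        have : w b + w b = (∑ c ∈ s, w c) + (∑ c ∈ s, w c) := by
          unfold nuLe at e e2
          rw [← e, add_comm (w b + w b), e2]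
        rw [add_eq_nu this]
        exact nu_ghost _
      have e3 := add_of_not_le e2
      rw [add_comm] at e3
      rw [e3] at h ⊢
      obtain ⟨a, ha, h1, h2⟩ := ih h
      refine ⟨a, Finset.mem_insert_of_mem ha, h1, ?_⟩
      intro c hc hca
      rcases Finset.mem_insert.1 hc with rfl | hc
      · rwa [← h1]
      · exact h2 c hc hca
    · refine ⟨b, Finset.mem_insert_self _ _, add_of_not_le e, ?_⟩
      intro c hc hcb h3
      rcases Finset.mem_insert.1 hc with rfl | hc
      · exact hcb rfl
      · exact e (le_trans h3 (le_sum s w hc))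

lemma add_sum_eq {ι : Type*} [DecidableEq ι] (s : Finset ι) (w : ι → R) (a : R) :
    (∀ b ∈ s, ¬ nuLe a (w b)) → a + ∑ b ∈ s, w b = a := by
  induction s using Finset.induction_on with
  | empty => simp
  | insert b s hb ih =>
    intro h
    rw [Finset.sum_insert hb, ← add_assoc, add_of_not_le (h b (by simp)),
      ih (fun c hc => h c (by simp [hc]))]

lemma gs_tangible {b a : R} (h : GS b a) (hb : tangible b) : b = a := by
  obtain ⟨c, hc, rfl⟩ := h
  by_cases e : a + a = c + c
  · exact absurd (by rw [add_eq_nu e]; exact nu_ghost a) hb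
  · rcases add_cases e with h1 | h1
    · exact h1
    · exact absurd (by rw [h1]; exact hc) hb

end basic

section field
variable {R : Type*} [SupertropicalSemifield R]

attribute [local instance] cs

lemma cancel {a b c : R} (hc : tangible c) (h : nuLe (a * c) (b * c)) : nuLe a b := by
  obtain ⟨d, -, hd⟩ := SupertropicalSemifield.tangible_inv hc
  have := mul_right h d
  rwa [mul_assoc, mul_assoc, hd, mul_one, mul_one] at this

lemma prod_le {ι : Type*} [DecidableEq ι] (s : Finset ι) (F G : ι → R)
    (h : ∀ i ∈ s, nuLe (F i) (G i)) : nuLe (∏ i ∈ s, F i) (∏ i ∈ s, G i) := by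
  induction s using Finset.induction_on with
  | empty => exact le_refl _
  | insert b s hb ih =>
    rw [Finset.prod_insert hb, Finset.prod_insert hb]
    exact mul_le (h b (by simp)) (ih fun i hi => h i (by simp [hi]))

lemma prod_tangible {ι : Type*} (s : Finset ι) (F : ι → R)
    (h : ∀ i ∈ s, tangible (F i)) : tangible (∏ i ∈ s, F i) :=
  Finset.prod_induction F (fun a => tangible a)
    (fun _ _ ha hb => SupertropicalDomain.tangible_mul ha hb) SupertropicalDomain.one_tangible h

lemma le_zero_ghost {a : R} (h : nuLe a 0) : ghost a := by
  unfold nuLe at h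
  rw [add_zero, add_zero] at h
  have := add_eq_nu (a := 0) (b := a) (by rw [h, add_zero])
  rw [zero_add, zero_add] at this
  rw [this]; exact ghost_zero

lemma core {ι : Type*} [Fintype ι] [DecidableEq ι] (M : ι → ι → R) (X V : ι → R)
    (hM : ∀ r, tangible (M r r))
    (hdom : ∀ τ : Equiv.Perm ι, τ ≠ 1 → ¬ nuLe (∏ r, M r r) (∏ r, M r (τ r)))
    (hX : ∀ r, tangible0 (X r))
    (hrow : ∀ r, tangible (X r) → nuLe (M r r * X r) (V r) ∨
      ∃ r', r' ≠ r ∧ nuLe (M r r * X r) (M r r' * X r'))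
    (r0 : ι) (h0 : tangible (X r0)) :
    ∃ (k : ι) (τ : Equiv.Perm ι), τ k = r0 ∧
      nuLe ((∏ r, M r r) * X r0) (∏ r, if r = k then V k else M r (τ r)) := by
  classical
  have hg : ∀ r, ∃ r', tangible (X r) → (tangible (X r') ∧
      ((nuLe (M r r * X r) (V r) ∧ r' = r0) ∨
        (r' ≠ r ∧ nuLe (M r r * X r) (M r r' * X r')))) := by
    intro r
    by_cases hr : tangible (X r)
    · rcases hrow r hr with h | ⟨r', h1, h2⟩
      · exact ⟨r0, fun _ => ⟨h0, Or.inl ⟨h, rfl⟩⟩⟩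
      · refine ⟨r', fun _ => ⟨?_, Or.inr ⟨h1, h2⟩⟩⟩
        rcases hX r' with h3 | h3
        · rw [h3, mul_zero] at h2
          exact absurd (le_zero_ghost h2) (SupertropicalDomain.tangible_mul (hM r) hr)
        · exact h3
    · exact ⟨r, fun h => absurd h hr⟩
  choose g hg using hg
  -- periodic tangible points
  let T : Set ι := {r | tangible (X r) ∧ r ∈ Function.periodicPts g}
  have hTg : ∀ r ∈ T, g r ∈ T := fun r hr =>
    ⟨(hg r hr.1).1, (Function.bijOn_periodicPts g).mapsTo hr.2⟩
  have hTinj : ∀ r ∈ T, ∀ r' ∈ T, g r = g r' → r = r' := fun r hr r' hr' h =>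
    (Function.bijOn_periodicPts g).injOn hr.2 hr'.2 h
  have hit : ∀ m, tangible (X (g^[m] r0)) := by
    intro m
    induction m with
    | zero => exact h0
    | succ m ih => rw [Function.iterate_succ_apply']; exact (hg _ ih).1
  obtain ⟨p, hp⟩ : ∃ p, p ∈ T := by
    obtain ⟨a, b, hab, h⟩ := Finite.exists_ne_map_eq_of_infinite (fun m : ℕ => g^[m] r0)
    wlog hlt : a < b generalizing a b
    · exact this b a hab.symm h.symm (by omega)
    refine ⟨g^[a] r0, hit a, b - a, by omega, ?_⟩
    change g^[b-a] (g^[a] r0) = g^[a] r0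
    rw [← Function.iterate_add_apply, Nat.sub_add_cancel hlt.le]
    exact h.symm
  let t : ι → ι := fun r => if r ∈ T then g r else r
  have ht : Function.Injective t := by
    intro r r' h
    simp only [t] at h
    split_ifs at h with h1 h2 h2
    · exact hTinj r h1 r' h2 h
    · exact absurd (h ▸ hTg r h1) h2
    · exact absurd (h ▸ hTg r' h2) h1
    · exact h
  let τ : Equiv.Perm ι := Equiv.ofBijective t (Finite.injective_iff_bijective.1 ht)
  have τT : ∀ r ∈ T, τ r = g r := fun r hr => by simp [τ, t, hr]
  have τN : ∀ r, r ∉ T → τ r = r := fun r hr => by simp [τ, t, hr]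
  let Y : ι → R := fun r => if r ∈ T then X r else 1
  have YT : ∀ r ∈ T, Y r = X r := fun r hr => by simp [Y, hr]
  have YN : ∀ r, r ∉ T → Y r = 1 := fun r hr => by simp [Y, hr]
  have Yt : ∀ r, tangible (Y r) := by
    intro r
    by_cases hr : r ∈ T
    · rw [YT r hr]; exact hr.1
    · rw [YN r hr]; exact SupertropicalDomain.one_tangible
  by_cases hk : ∃ k ∈ T, nuLe (M k k * X k) (V k) ∧ g k = r0
  · obtain ⟨k, hkT, hk1, hk2⟩ := hk
    have hr0T : r0 ∈ T := hk2 ▸ hTg k hkT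
    refine ⟨k, τ, by rw [τT k hkT, hk2], ?_⟩
    have hτk : ∀ r, τ r = r0 ↔ r = k := by
      intro r
      rw [← hk2, ← τT k hkT]
      exact τ.injective.eq_iff
    let Z : ι → R := fun r => if r = r0 then 1 else Y r
    have hZ : tangible (∏ r, Z r) := by
      apply prod_tangible
      intro r _
      simp only [Z]
      split_ifs
      · exact SupertropicalDomain.one_tangible
      · exact Yt r
    apply cancel hZ
    have e1 : X r0 * ∏ r, Z r = ∏ r, Y r := by
      rw [← Finset.mul_prod_erase _ Y (Finset.mem_univ r0),
        ← Finset.mul_prod_erase _ Z (Finset.mem_univ r0), YT r0 hr0T]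
      have : Z r0 = 1 := by simp [Z]
      rw [this, one_mul]
      congr 1
      apply Finset.prod_congr rfl
      intro r hr
      simp [Z, Finset.ne_of_mem_erase hr]
    rw [mul_assoc, e1, ← Equiv.prod_comp τ Z, ← Finset.prod_mul_distrib,
      ← Finset.prod_mul_distrib]
    apply prod_le
    intro r _
    by_cases hrk : r = k
    · have : Z (τ r) = 1 := by simp [Z, (hτk r).2 hrk]
      rw [this, if_pos hrk, mul_one, hrk, YT k hkT]
      exact hk1
    · have : Z (τ r) = Y (τ r) := by simp [Z, hτk r, hrk]
      rw [this, if_neg hrk]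
      by_cases hrT : r ∈ T
      · rw [τT r hrT, YT r hrT, YT _ (hTg r hrT)]
        rcases (hg r hrT.1).2 with h | h
        · exact absurd (hTinj r hrT k hkT (by rw [h.2, hk2])) hrk
        · exact h.2
      · rw [τN r hrT]; exact le_refl _
  · exfalso
    have hno : ∀ r ∈ T, g r ≠ r ∧ nuLe (M r r * X r) (M r (g r) * X (g r)) := by
      intro r hr
      rcases (hg r hr.1).2 with h | h
      · exact absurd ⟨r, hr, h⟩ hk
      · exact h
    refine hdom τ ?_ ?_
    · intro h
      apply (hno p hp).1
      rw [← τT p hp, h]; rfl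
    · apply cancel (prod_tangible Finset.univ Y fun r _ => Yt r)
      conv => arg 2; arg 2; rw [← Equiv.prod_comp τ Y]
      rw [← Finset.prod_mul_distrib, ← Finset.prod_mul_distrib]
      apply prod_le
      intro r _
      by_cases hrT : r ∈ T
      · rw [τT r hrT, YT r hrT, YT _ (hTg r hrT)]
        exact (hno r hrT).2
      · rw [τN r hrT]; exact le_refl _

lemma per_eq {n : ℕ} (A : Matrix (Fin n) (Fin n) R) :
    per A = ∑ σ : Equiv.Perm (Fin n), ∏ i, A i (σ i) := by
  unfold per
  apply Finset.sum_congr rfl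
  intro σ _
  exact List.prod_ofFn

lemma adj_ge {n : ℕ} (A : Matrix (Fin (n + 1)) (Fin (n + 1)) R) (i k : Fin (n + 1))
    (π : Equiv.Perm (Fin (n + 1))) (h : π k = i) :
    nuLe (∏ j, A (k.succAbove j) (π (k.succAbove j))) (adj A i k) := by
  have : ∀ j, ∃ j', i.succAbove j' = π (k.succAbove j) := by
    intro j
    apply Fin.exists_succAbove_eq
    rw [← h]
    exact fun e => Fin.succAbove_ne k j (π.injective e)
  choose ρ hρ using this
  have hi : Function.Injective ρ := by
    intro a b e
    have := hρ a
    rw [e, hρ b] at this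
    exact (Fin.succAbove_right_injective (π.injective this)).symm
  let ρ' : Equiv.Perm (Fin n) := Equiv.ofBijective ρ (Finite.injective_iff_bijective.1 hi)
  unfold adj
  rw [per_eq]
  have := le_sum Finset.univ
    (fun σ : Equiv.Perm (Fin n) =>
      ∏ j, A.submatrix k.succAbove i.succAbove j (σ j)) (Finset.mem_univ ρ')
  convert this using 1
  apply Finset.prod_congr rfl
  intro j _
  simp [ρ', hρ]

lemma retract_nu (f : TangibleRetract R) (y : R) : nuLe y (f y) := by
  by_cases h : ghost y
  · unfold nuLe
    rw [f.nu_section y h]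
    have h2 := nu_idem (f y)
    rw [f.nu_section y h] at h2
    rw [h2, h2]
  · rw [f.id_on_T0 y (Or.inr h)]
    exact le_refl y

theorem main (f : ST.TangibleRetract R) {n : ℕ} (A : Matrix (Fin (n + 1)) (Fin (n + 1)) R)
    (hA : ST.tangible (ST.per A)) (u : R) (hu : ST.per A * u = 1)
    (v : Fin (n + 1) → R)
    (x : Fin (n + 1) → R) (hx : ∀ i, ST.tangible0 (x i))
    (hAx : ∀ i, ST.GS (∑ j, A i j * x j) (v i)) (i : Fin (n + 1)) :
    ST.nuLe (x i) (f (∑ j, (u * ST.adj A i j) * v j)) := by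
  refine le_trans ?_ (retract_nu f _)
  rcases hx i with h0 | h0
  · rw [h0]; unfold nuLe; simp
  obtain ⟨s, -, hs, hdom⟩ := sum_tangible _ _ (by rwa [per_eq] at hA)
  rw [← per_eq] at hs
  beta_reduce at hs hdom
  have hent : ∀ r, tangible (A r (s r)) := by
    intro r hr
    apply hA
    rw [hs, ← Finset.mul_prod_erase _ _ (Finset.mem_univ r)]
    exact ghost_mul_right _ hr
  obtain ⟨k, τ, hk, hle⟩ := core (fun r r' => A r (s r')) (fun r => x (s r)) v hent
    (by
      intro τ hτ
      exact hdom (s * τ) (Finset.mem_univ _) (by simpa using hτ))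
    (fun r => hx _)
    (by
      intro r hr
      by_cases hgh : ghost (∑ j, A r j * x j)
      · right
        by_contra! hcon
        have h1 := add_sum_eq (Finset.univ.erase (s r)) (fun j => A r j * x j)
          (A r (s r) * x (s r)) (by
            intro j hj
            have := hcon (s.symm j) (by
              intro e; exact Finset.ne_of_mem_erase hj (by rw [← e]; simp))
            simpa using this)
        rw [Finset.add_sum_erase _ (fun j => A r j * x j) (Finset.mem_univ _)] at h1
        rw [h1] at hgh
        exact SupertropicalDomain.tangible_mul (hent r) hr hgh
      · left
        rw [← gs_tangible (hAx r) hgh]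
        exact le_sum Finset.univ (fun j => A r j * x j) (Finset.mem_univ _))
    (s.symm i) (by simpa using h0)
  simp only [Equiv.apply_symm_apply] at hle
  rw [← hs, Fin.prod_univ_succAbove _ k] at hle
  simp only [if_true, Fin.succAbove_ne, if_false] at hle
  have h1 := adj_ge A i k (s * τ) (by simp [hk])
  have h2 := mul_left (le_trans hle (mul_left h1 (v k))) u
  have e1 : u * (per A * x i) = x i := by
    rw [← mul_assoc, mul_comm u, hu, one_mul]
  rw [e1] at h2
  refine le_trans h2 ?_
  have e2 : u * (v k * adj A i k) = u * adj A i k * v k := by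
    rw [mul_comm (v k), mul_assoc]
  rw [e2]
  exact le_sum Finset.univ (fun j => u * adj A i j * v j) (Finset.mem_univ k)

end field

end CM

/-- Maximality of the Cramer solution: any tangible solution `x`
of `A x ⊨ v` satisfies `x ≤_ν ν̂(A^∇ v)` componentwise. -/
theorem cramer_maximal {R : Type*} [SupertropicalSemifield R]
    (f : ST.TangibleRetract R) {n : ℕ} (A : Matrix (Fin (n + 1)) (Fin (n + 1)) R)
    (hA : ST.tangible (ST.per A)) (u : R) (hu : ST.per A * u = 1)
    (v : Fin (n + 1) → R) (hv : ∀ i, ST.tangible0 (v i))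
    (x : Fin (n + 1) → R) (hx : ∀ i, ST.tangible0 (x i))
    (hAx : ∀ i, ST.GS (A.mulVec x i) (v i)) :
    ∀ i, ST.nuLe (x i) (f ((u • ST.adj A).mulVec v i)) := by
  intro i
  exact CM.main f A hA u hu v x hx hAx i
end
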